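/- Let h and k be natural numbers with h ≥ 2 and k ≥ 2. Then W(k,h) ≤ k² − √2·k^{3/2} + 4k; that is, for every integer s ≥ k² − √2·k^{3/2} + 4k there exists an s×h array of integers (x_{iu}) such that Σ_{i=1}^s x_{i1}^j = Σ_{i=1}^s x_{i2}^j = ⋯ = Σ_{i=1}^s x_{ih}^j for every j with 1 ≤ j ≤ k, while the h values Σ_{i=1}^s x_{iu}^{k+1} (1 ≤ u ≤ h) are pairwise distinct. -/

import Mathlib

set_option linter.unusedSectionVars false
namespace EC
open Finset

section chars
variable {G : Type} [AddCommGroup G] [Fintype G] [DecidableEq G]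

theorem char_count {Z : Type} (S : Finset Z) (g : Z → G) :
    ∑ ψ : AddChar G ℂ, ‖∑ z ∈ S, ψ (g z)‖ ^ 2 =
      (Fintype.card G : ℝ) * (((S ×ˢ S).filter (fun q => g q.1 = g q.2)).card : ℝ) := by
  have key : (∑ ψ : AddChar G ℂ, ((‖∑ z ∈ S, ψ (g z)‖ ^ 2 : ℝ) : ℂ)) =
      (Fintype.card G : ℂ) * (((S ×ˢ S).filter (fun q => g q.1 = g q.2)).card : ℂ) := by
    have h1 : ∀ ψ : AddChar G ℂ, ((‖∑ z ∈ S, ψ (g z)‖ ^ 2 : ℝ) : ℂ) =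
        ∑ q ∈ S ×ˢ S, ψ (g q.1 - g q.2) := by
      intro ψ
      push_cast
      rw [← Complex.mul_conj', map_sum, Finset.sum_mul_sum, ← Finset.sum_product']
      refine Finset.sum_congr rfl fun q _ => ?_
      rw [AddChar.map_sub_eq_div, ← AddChar.map_neg_eq_conj, AddChar.map_neg_eq_inv, div_eq_mul_inv]
    simp_rw [h1]
    rw [Finset.sum_comm]
    simp_rw [AddChar.sum_apply_eq_ite, sub_eq_zero]
    rw [← Finset.sum_filter, Finset.sum_const, nsmul_eq_mul, mul_comm]
  exact_mod_cast key

/-- exponential sum over a finite set -/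
noncomputable def fs (γ : ℕ → G) (A : Finset ℕ) (ψ : AddChar G ℂ) : ℂ := ∑ x ∈ A, ψ (γ x)

theorem prod_fs {ι : Type} [Fintype ι] [DecidableEq ι] (γ : ℕ → G) (A : ι → Finset ℕ)
    (ψ : AddChar G ℂ) :
    ∏ i, fs γ (A i) ψ = ∑ x ∈ Fintype.piFinset A, ψ (∑ i, γ (x i)) := by
  unfold fs
  rw [Finset.prod_univ_sum]
  refine Finset.sum_congr rfl fun x _ => ?_
  exact (map_prod ψ.toMonoidHom (fun i => Multiplicative.ofAdd (γ (x i))) univ).symm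

/-- number of solutions -/
def cnt {ι : Type} [Fintype ι] [DecidableEq ι] (γ : ℕ → G) (A : ι → Finset ℕ) : ℕ :=
  ((Fintype.piFinset A ×ˢ Fintype.piFinset A).filter
    (fun q => ∑ i, γ (q.1 i) = ∑ i, γ (q.2 i))).card

theorem mean_eq {ι : Type} [Fintype ι] [DecidableEq ι] (γ : ℕ → G) (A : ι → Finset ℕ) :
    ∑ ψ : AddChar G ℂ, ∏ i, ‖fs γ (A i) ψ‖ ^ 2 = (Fintype.card G : ℝ) * (cnt γ A : ℝ) := by
  rw [cnt, ← char_count (Fintype.piFinset A) (fun x => ∑ i, γ (x i))]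
  refine Finset.sum_congr rfl fun ψ _ => ?_
  rw [← prod_fs, norm_prod, Finset.prod_pow]

theorem cnt_mono {ι : Type} [Fintype ι] [DecidableEq ι] (γ : ℕ → G) {A A' : ι → Finset ℕ}
    (h : ∀ i, A i ⊆ A' i) : cnt γ A ≤ cnt γ A' := by
  unfold cnt
  have := Fintype.piFinset_subset A A' h
  exact Finset.card_le_card (Finset.filter_subset_filter _ (Finset.product_subset_product this this))

theorem mean_mono {ι : Type} [Fintype ι] [DecidableEq ι] (γ : ℕ → G) {A A' : ι → Finset ℕ}
    (h : ∀ i, A i ⊆ A' i) :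
    ∑ ψ : AddChar G ℂ, ∏ i, ‖fs γ (A i) ψ‖ ^ 2 ≤ ∑ ψ : AddChar G ℂ, ∏ i, ‖fs γ (A' i) ψ‖ ^ 2 := by
  rw [mean_eq, mean_eq]
  have := cnt_mono γ h
  gcongr

theorem orth {α β ρ : Type} [DecidableEq ρ] (X : Finset α) (Y : Finset β)
    (g : α → G) (h : β → G) (r : α → ρ)
    (hyp : ∀ x ∈ X, ∀ x' ∈ X, ∀ y ∈ Y, ∀ y' ∈ Y, g x + h y = g x' + h y' → r x = r x') :
    ∑ ψ : AddChar G ℂ, ‖∑ x ∈ X, ψ (g x)‖ ^ 2 * ‖∑ y ∈ Y, ψ (h y)‖ ^ 2 ≤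
      ∑ R ∈ X.image r, ∑ ψ : AddChar G ℂ,
        ‖∑ x ∈ X.filter (fun x => r x = R), ψ (g x)‖ ^ 2 * ‖∑ y ∈ Y, ψ (h y)‖ ^ 2 := by
  have conv : ∀ X' : Finset α, ∑ ψ : AddChar G ℂ, ‖∑ x ∈ X', ψ (g x)‖ ^ 2 * ‖∑ y ∈ Y, ψ (h y)‖ ^ 2
      = (Fintype.card G : ℝ) * ((((X' ×ˢ Y) ×ˢ (X' ×ˢ Y)).filter
          (fun q => g q.1.1 + h q.1.2 = g q.2.1 + h q.2.2)).card : ℝ) := by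
    intro X'
    rw [← char_count (X' ×ˢ Y) (fun z => g z.1 + h z.2)]
    refine Finset.sum_congr rfl fun ψ _ => ?_
    rw [← mul_pow, ← norm_mul, Finset.sum_mul_sum, ← Finset.sum_product']
    congr 2
    refine Finset.sum_congr rfl fun z _ => ?_
    rw [AddChar.map_add_eq_mul]
  simp_rw [conv]
  rw [← Finset.mul_sum]
  have hG : (0 : ℝ) ≤ Fintype.card G := by positivity
  refine mul_le_mul_of_nonneg_left ?_ hG
  classical
  have : ((((X ×ˢ Y) ×ˢ (X ×ˢ Y)).filter
          (fun q => g q.1.1 + h q.1.2 = g q.2.1 + h q.2.2))) ⊆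
      (X.image r).biUnion (fun R => ((((X.filter (fun x => r x = R)) ×ˢ Y) ×ˢ
        ((X.filter (fun x => r x = R)) ×ˢ Y)).filter
          (fun q => g q.1.1 + h q.1.2 = g q.2.1 + h q.2.2))) := by
    intro q hq
    simp only [mem_filter, mem_product] at hq
    obtain ⟨⟨⟨h1, h2⟩, h3, h4⟩, h5⟩ := hq
    simp only [mem_biUnion, mem_image, mem_filter, mem_product]
    refine ⟨r q.1.1, ⟨q.1.1, h1, rfl⟩, ⟨⟨⟨h1, rfl⟩, h2⟩, ⟨h3, ?_⟩, h4⟩, h5⟩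
    exact (hyp _ h1 _ h3 _ h2 _ h4 h5).symm
  calc _ ≤ (((X.image r).biUnion (fun R => ((((X.filter (fun x => r x = R)) ×ˢ Y) ×ˢ
        ((X.filter (fun x => r x = R)) ×ˢ Y)).filter
          (fun q => g q.1.1 + h q.1.2 = g q.2.1 + h q.2.2)))).card : ℝ) := by
        exact_mod_cast Finset.card_le_card this
    _ ≤ _ := by exact_mod_cast Finset.card_biUnion_le

end chars

/-- Hölder -/
theorem holder {Ω : Type} (S : Finset Ω) (u v : Ω → ℝ) (θ : ℝ) (h0 : 0 < θ) (h1 : θ < 1)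
    (hu : ∀ i ∈ S, 0 ≤ u i) (hv : ∀ i ∈ S, 0 ≤ v i) :
    ∑ i ∈ S, u i ^ θ * v i ^ (1 - θ) ≤ (∑ i ∈ S, u i) ^ θ * (∑ i ∈ S, v i) ^ (1 - θ) := by
  have hpq : Real.HolderConjugate (1 / θ) (1 / (1 - θ)) := by
    rw [Real.holderConjugate_iff]
    constructor
    · rw [lt_div_iff₀ h0]; linarith
    · simp
  have := Real.inner_le_Lp_mul_Lq_of_nonneg S hpq (f := fun i => u i ^ θ) (g := fun i => v i ^ (1 - θ))
    (fun i hi => Real.rpow_nonneg (hu i hi) _) (fun i hi => Real.rpow_nonneg (hv i hi) _)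
  refine this.trans (le_of_eq ?_)
  have e1 : ∑ i ∈ S, (u i ^ θ) ^ (1 / θ) = ∑ i ∈ S, u i := by
    refine Finset.sum_congr rfl fun i hi => ?_
    rw [← Real.rpow_mul (hu i hi), mul_one_div_cancel h0.ne', Real.rpow_one]
  have e2 : ∑ i ∈ S, (v i ^ (1 - θ)) ^ (1 / (1 - θ)) = ∑ i ∈ S, v i := by
    refine Finset.sum_congr rfl fun i hi => ?_
    rw [← Real.rpow_mul (hv i hi), mul_one_div_cancel (by linarith), Real.rpow_one]
  rw [e1, e2]
  simp
end EC

set_option linter.unusedSectionVars false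
namespace EC
open Finset

theorem hensel (p K m : ℕ) [Fact p.Prime] (hK : K < p) (q q' : Fin K → ℤ)
    (hinj : ∀ i j, q i ≡ q j [ZMOD p] → i = j) (h1 : ∀ i, q i ≡ q' i [ZMOD p])
    (hs : ∀ j < K, ∑ i, q i ^ (j + 1) ≡ ∑ i, q' i ^ (j + 1) [ZMOD (p : ℤ) ^ m]) :
    ∀ i, q i ≡ q' i [ZMOD (p : ℤ) ^ m] := by
  have hp : (p : ℤ) ≠ 0 := by exact_mod_cast (Fact.out : p.Prime).ne_zero
  have key : ∀ l, l ≤ m → ∀ i, q i ≡ q' i [ZMOD (p : ℤ) ^ l] := by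
    intro l
    induction l with
    | zero => intro _ i; simp [Int.modEq_one]
    | succ l ih =>
      intro hl
      rcases Nat.eq_zero_or_pos l with rfl | hl0
      · simpa using h1
      have ih' := ih (by omega)
      have hd : ∀ i, ∃ d, q' i = q i + (p : ℤ) ^ l * d := by
        intro i
        obtain ⟨d, hd⟩ := (ih' i).dvd
        exact ⟨d, by linarith⟩
      choose d hd using hd
      have hz : (fun i => ((d i : ℤ) : ZMod p)) = 0 := by
        apply Matrix.eq_zero_of_forall_pow_sum_mul_pow_eq_zero (f := fun i => ((q i : ℤ) : ZMod p))
        · intro i j hij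
          exact hinj i j ((ZMod.intCast_eq_intCast_iff _ _ _).1 hij)
        · intro j
          have hj := (hs j j.2).dvd
          have hdv : (p : ℤ) ^ (l + 1) ∣ (p : ℤ) ^ l * (((j : ℕ) + 1 : ℤ) * ∑ i, d i * q i ^ (j : ℕ)) := by
            have h2 : (p : ℤ) ^ (l + 1) ∣ ∑ i, q' i ^ ((j : ℕ) + 1) - ∑ i, q i ^ ((j : ℕ) + 1) :=
              (pow_dvd_pow _ hl).trans hj
            have h3 : ∑ i, q' i ^ ((j : ℕ) + 1) - ∑ i, q i ^ ((j : ℕ) + 1)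
                = (p : ℤ) ^ l * (((j : ℕ) + 1 : ℤ) * ∑ i, d i * q i ^ (j : ℕ)) +
                  ∑ i, (Polynomial.powAddExpansion (q i) ((p : ℤ) ^ l * d i) ((j : ℕ) + 1)).1 *
                    ((p : ℤ) ^ l * d i) ^ 2 := by
              rw [← Finset.sum_sub_distrib, Finset.mul_sum, Finset.mul_sum, ← Finset.sum_add_distrib]
              refine Finset.sum_congr rfl fun i _ => ?_
              have h9 := (Polynomial.powAddExpansion (q i) ((p : ℤ) ^ l * d i) ((j : ℕ) + 1)).2
              simp only [Nat.add_sub_cancel] at h9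
              push_cast at h9
              rw [hd i]
              linear_combination h9
            rw [h3] at h2
            refine (Int.dvd_add_left ?_).1 h2
            refine Finset.dvd_sum fun i _ => ?_
            refine Dvd.dvd.mul_left ?_ _
            rw [mul_pow, ← pow_mul]
            exact Dvd.dvd.mul_right (pow_dvd_pow _ (by omega)) _
          rw [pow_succ] at hdv
          have h4 := Int.dvd_of_mul_dvd_mul_left (pow_ne_zero l hp) hdv
          have h5 : (((((j : ℕ) + 1 : ℤ) * ∑ i, d i * q i ^ (j : ℕ)) : ℤ) : ZMod p) = 0 :=
            (ZMod.intCast_zmod_eq_zero_iff_dvd _ _).2 h4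
          push_cast at h5
          rcases mul_eq_zero.1 h5 with h6 | h6
          · exfalso
            have h7 : ((((j : ℕ) + 1 : ℕ)) : ZMod p) = 0 := by push_cast; exact h6
            rw [ZMod.natCast_eq_zero_iff] at h7
            have := Nat.le_of_dvd (by omega) h7
            omega
          · exact h6
      intro i
      have h8 : ((d i : ℤ) : ZMod p) = 0 := congrFun hz i
      obtain ⟨e, he⟩ := (ZMod.intCast_zmod_eq_zero_iff_dvd _ _).1 h8
      rw [Int.modEq_iff_dvd]
      refine ⟨e, ?_⟩
      rw [hd i, he]; ring
  exact key m le_rfl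

theorem shift {ι : Type} [Fintype ι] (M c d : ℤ) (n : ℕ) (x y : ι → ℤ)
    (h : ∀ j, j < n → ∑ i, (x i - c) ^ (j + 1) ≡ ∑ i, (y i - c) ^ (j + 1) [ZMOD M]) :
    ∀ j, j < n → ∑ i, (x i - d) ^ (j + 1) ≡ ∑ i, (y i - d) ^ (j + 1) [ZMOD M] := by
  intro j hj
  have e : ∀ z : ι → ℤ, ∑ i, (z i - d) ^ (j + 1) =
      ∑ l ∈ range (j + 2), ((c - d) ^ (j + 1 - l) * ((j + 1).choose l : ℤ)) * ∑ i, (z i - c) ^ l := by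
    intro z
    have : ∀ i, (z i - d) ^ (j + 1) = ∑ l ∈ range (j + 2),
        ((c - d) ^ (j + 1 - l) * ((j + 1).choose l : ℤ)) * (z i - c) ^ l := by
      intro i
      have : z i - d = (z i - c) + (c - d) := by ring
      rw [this, add_pow]
      refine Finset.sum_congr rfl fun l _ => ?_
      ring
    simp_rw [this, Finset.mul_sum]
    rw [Finset.sum_comm]
  rw [e x, e y]
  apply Int.ModEq.sum
  intro l hl
  apply Int.ModEq.mul_left
  rcases l with _ | l
  · simp [Int.ModEq.refl]
  · exact h l (by simp at hl; omega)

theorem residue_card (p M m : ℕ) (hp : 0 < p) (hm : m ≤ M) (c : ℤ) :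
    ((Finset.Ico (0 : ℤ) ((p : ℤ) ^ M)).filter (fun v => v % (p : ℤ) ^ m = c)).card ≤ p ^ (M - m) := by
  have hpm : (0 : ℤ) < (p : ℤ) ^ m := by positivity
  have : (Finset.Ico (0 : ℤ) ((p : ℤ) ^ (M - m))).card = p ^ (M - m) := by
    rw [Int.card_Ico, sub_zero]
    exact_mod_cast Int.toNat_natCast (p ^ (M - m))
  rw [← this]
  refine Finset.card_le_card_of_injOn (fun v => v / (p : ℤ) ^ m) ?_ ?_
  · intro v hv
    simp only [coe_filter, mem_Ico, Set.mem_ofPred_eq] at hv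
    simp only [coe_Ico, Set.mem_Ico]
    refine ⟨Int.ediv_nonneg hv.1.1 hpm.le, ?_⟩
    apply Int.ediv_lt_of_lt_mul hpm
    rw [← pow_add, Nat.sub_add_cancel hm]
    exact hv.1.2
  · intro v hv w hw hvw
    simp only [coe_filter, mem_Ico, Set.mem_ofPred_eq] at hv hw
    simp only at hvw
    rw [← Int.emod_add_mul_ediv v ((p : ℤ) ^ m), ← Int.emod_add_mul_ediv w ((p : ℤ) ^ m), hv.2, hw.2, hvw]

/-- conditioned tuple at level `a` -/
def Cond (p K a ξ0 : ℕ) (ξ : Fin K → ℕ) : Prop :=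
  (∀ i, ξ i < p ^ (a + 1)) ∧ (∀ i, ξ i % p ^ a = ξ0) ∧ Function.Injective ξ

/-- tuples of residues -/
def ZZ (p K a b' : ℕ) (ξ : Fin K → ℕ) : Finset (Fin K → ℕ) :=
  Fintype.piFinset (fun i => (range (p ^ b')).filter (fun x => x % p ^ (a + 1) = ξ i))

/-- residue data -/
def rr (p K b b' η : ℕ) (z : Fin K → ℕ) : Fin K → ℤ :=
  fun j => (∑ i, ((z i : ℤ) - η) ^ ((j : ℕ) + 1)) % (p : ℤ) ^ (min (((j : ℕ) + 1) * b) b')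

theorem fiber_card (p K a b b' η ξ0 : ℕ) [Fact p.Prime] (hK : K < p) (ξ : Fin K → ℕ)
    (hξ : Cond p K a ξ0 ξ) (hab : a ≤ b') (R : Fin K → ℤ) :
    ((ZZ p K a b' ξ).filter (fun z => rr p K b b' η z = R)).card ≤
      p ^ (∑ j : Fin K, (b' - ((j : ℕ) + 1) * b) + ∑ j : Fin K, (j : ℕ) * a) := by
  have hp0 : 0 < p := (Fact.out : p.Prime).pos
  obtain ⟨hξ1, hξ2, hξ3⟩ := hξ
  set Φ := (ZZ p K a b' ξ).filter (fun z => rr p K b b' η z = R) with hΦ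
  let m1 : (Fin K → ℕ) → (Fin K → ℤ) :=
    fun z j => (∑ i, ((z i : ℤ) - η) ^ ((j : ℕ) + 1)) % (p : ℤ) ^ b'
  let m2 : (Fin K → ℕ) → (Fin K → ℤ) :=
    fun z j => (∑ i, ((z i / p ^ a : ℕ) : ℤ) ^ ((j : ℕ) + 1)) % (p : ℤ) ^ (b' - a)
  have hb' : (0 : ℤ) < (p : ℤ) ^ b' := by positivity
  have hba : (0 : ℤ) < (p : ℤ) ^ (b' - a) := by positivity
  -- image of m1
  have him1 : (Φ.image m1).card ≤ p ^ (∑ j : Fin K, (b' - ((j : ℕ) + 1) * b)) := by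
    have hsub : Φ.image m1 ⊆ Fintype.piFinset (fun j : Fin K =>
        (Finset.Ico (0 : ℤ) ((p : ℤ) ^ b')).filter
          (fun v => v % (p : ℤ) ^ (min (((j : ℕ) + 1) * b) b') = R j)) := by
      intro v hv
      obtain ⟨z, hz, rfl⟩ := Finset.mem_image.1 hv
      rw [Fintype.mem_piFinset]
      intro j
      simp only [mem_filter, mem_Ico]
      refine ⟨⟨Int.emod_nonneg _ hb'.ne', Int.emod_lt_of_pos _ hb'⟩, ?_⟩
      have h1 : rr p K b b' η z = R := (Finset.mem_filter.1 hz).2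
      rw [← h1]
      exact Int.emod_emod_of_dvd _ (pow_dvd_pow _ (min_le_right _ _))
    refine (Finset.card_le_card hsub).trans ?_
    rw [Fintype.card_piFinset, ← Finset.prod_pow_eq_pow_sum]
    refine Finset.prod_le_prod' fun j _ => ?_
    refine (residue_card p b' _ hp0 (min_le_right _ _) _).trans (le_of_eq ?_)
    congr 1
    omega
  have hdecomp : ∀ z ∈ ZZ p K a b' ξ, ∀ i, (z i : ℤ) - ξ0 = (p : ℤ) ^ a * ((z i / p ^ a : ℕ) : ℤ) := by
    intro z hz i
    have h1 := (Fintype.mem_piFinset.1 hz) i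
    simp only [mem_filter, mem_range] at h1
    have h2 : z i % p ^ a = ξ0 := by
      rw [← hξ2 i, ← h1.2, Nat.mod_mod_of_dvd _ (pow_dvd_pow p (Nat.le_succ a))]
    have h3 := Nat.mod_add_div (z i) (p ^ a)
    rw [h2] at h3
    have : (z i : ℤ) = ((ξ0 + p ^ a * (z i / p ^ a) : ℕ) : ℤ) := by rw [h3]
    rw [this]; push_cast; ring
  have hfib : ∀ v ∈ Φ.image m1, (Φ.filter (fun z => m1 z = v)).card ≤ p ^ (∑ j : Fin K, (j : ℕ) * a) := by
    intro v hv
    obtain ⟨z0, hz0, rfl⟩ := Finset.mem_image.1 hv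
    have hz0' := (Finset.mem_filter.1 hz0).1
    have hcong : ∀ z ∈ Φ.filter (fun z => m1 z = m1 z0), ∀ j : ℕ, j < K →
        ∑ i, ((z i / p ^ a : ℕ) : ℤ) ^ (j + 1) ≡ ∑ i, ((z0 i / p ^ a : ℕ) : ℤ) ^ (j + 1)
          [ZMOD (p : ℤ) ^ (b' - a * (j + 1))] := by
      intro z hz j hj
      obtain ⟨hz1, hz2⟩ := Finset.mem_filter.1 hz
      have hz1' := (Finset.mem_filter.1 hz1).1
      have hsh := shift ((p : ℤ) ^ b') η ξ0 K (fun i => (z i : ℤ)) (fun i => (z0 i : ℤ))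
        (fun j hj => congrFun hz2 ⟨j, hj⟩) j hj
      simp only [hdecomp z hz1', hdecomp z0 hz0', mul_pow, ← Finset.mul_sum, ← pow_mul] at hsh
      rcases le_total (a * (j + 1)) b' with hle | hle
      · have hd := hsh.dvd
        rw [← mul_sub] at hd
        rw [Int.modEq_iff_dvd]
        have : (p : ℤ) ^ b' = (p : ℤ) ^ (a * (j + 1)) * (p : ℤ) ^ (b' - a * (j + 1)) := by
          rw [← pow_add]; congr 1; omega
        rw [this] at hd
        exact Int.dvd_of_mul_dvd_mul_left (by positivity) hd
      · rw [Nat.sub_eq_zero_of_le hle, pow_zero]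
        exact Int.modEq_one
    have hsub : (Φ.filter (fun z => m1 z = m1 z0)).image m2 ⊆ Fintype.piFinset (fun j : Fin K =>
        (Finset.Ico (0 : ℤ) ((p : ℤ) ^ (b' - a))).filter
          (fun v => v % (p : ℤ) ^ (b' - a * ((j : ℕ) + 1)) =
            (∑ i, ((z0 i / p ^ a : ℕ) : ℤ) ^ ((j : ℕ) + 1)) % (p : ℤ) ^ (b' - a * ((j : ℕ) + 1)))) := by
      intro v hv
      obtain ⟨z, hz, rfl⟩ := Finset.mem_image.1 hv
      rw [Fintype.mem_piFinset]
      intro j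
      simp only [mem_filter, mem_Ico]
      refine ⟨⟨Int.emod_nonneg _ hba.ne', Int.emod_lt_of_pos _ hba⟩, ?_⟩
      rw [Int.emod_emod_of_dvd _ (pow_dvd_pow _ (by rw [mul_add]; omega))]
      exact hcong z hz j j.2
    have hinj : Set.InjOn m2 ((Φ.filter (fun z => m1 z = m1 z0)) : Finset (Fin K → ℕ)) := by
      intro z hz z' hz' hzz
      have hzZ := (Finset.mem_filter.1 (Finset.mem_filter.1 hz).1).1
      have hzZ' := (Finset.mem_filter.1 (Finset.mem_filter.1 hz').1).1
      have hq : ∀ w ∈ ZZ p K a b' ξ, ∀ i, (w i / p ^ a) % p = ξ i / p ^ a := by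
        intro w hw i
        have h1 := (Fintype.mem_piFinset.1 hw) i
        simp only [mem_filter, mem_range] at h1
        rw [← h1.2, pow_succ, Nat.mod_mul_right_div_self]
      have hlt : ∀ w ∈ ZZ p K a b' ξ, ∀ i, (w i / p ^ a) < p ^ (b' - a) := by
        intro w hw i
        have h1 := (Fintype.mem_piFinset.1 hw) i
        simp only [mem_filter, mem_range] at h1
        rw [Nat.div_lt_iff_lt_mul (by positivity), ← pow_add, Nat.sub_add_cancel hab]
        exact h1.1
      have hh := hensel p K (b' - a) hK (fun i => ((z i / p ^ a : ℕ) : ℤ))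
        (fun i => ((z' i / p ^ a : ℕ) : ℤ)) ?_ ?_ ?_
      · funext i
        have h1 := hh i
        have h2 : z i / p ^ a ≡ z' i / p ^ a [MOD p ^ (b' - a)] := by
          rw [← Int.natCast_modEq_iff]; push_cast at h1 ⊢; exact h1
        have h3 := Nat.ModEq.eq_of_lt_of_lt h2 (hlt z hzZ i) (hlt z' hzZ' i)
        have h4 := hdecomp z hzZ i
        have h5 := hdecomp z' hzZ' i
        rw [h3] at h4
        have : (z i : ℤ) = z' i := by linarith
        exact_mod_cast this
      · intro i j hij
        have h1 : z i / p ^ a ≡ z j / p ^ a [MOD p] := by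
          rw [← Int.natCast_modEq_iff]; exact hij
        unfold Nat.ModEq at h1
        rw [hq z hzZ, hq z hzZ] at h1
        apply hξ3
        rw [← Nat.mod_add_div (ξ i) (p ^ a), ← Nat.mod_add_div (ξ j) (p ^ a), hξ2, hξ2, h1]
      · intro i
        have : z i / p ^ a ≡ z' i / p ^ a [MOD p] := by
          unfold Nat.ModEq
          rw [hq z hzZ, hq z' hzZ']
        exact (Int.natCast_modEq_iff).2 this
      · intro j hj
        exact congrFun hzz ⟨j, hj⟩
    rw [← Finset.card_image_of_injOn hinj]
    refine (Finset.card_le_card hsub).trans ?_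
    rw [Fintype.card_piFinset, ← Finset.prod_pow_eq_pow_sum]
    refine Finset.prod_le_prod' fun j _ => ?_
    refine (residue_card p _ _ hp0 (by rw [mul_add]; omega) _).trans ?_
    refine Nat.pow_le_pow_right hp0 ?_
    rw [mul_add, mul_comm a]; omega
  have := Finset.card_le_mul_card_image Φ _ hfib
  refine this.trans ?_
  rw [pow_add, mul_comm]
  exact Nat.mul_le_mul_right _ him1
end EC


set_option linter.unusedSectionVars false
namespace EC
open Finset

/-- residue class -/
def cls (p B b η : ℕ) : Finset ℕ := (range (p ^ B)).filter (fun x => x % p ^ b = η)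

/-- residues over a coarser residue -/
def lft (p b b' η : ℕ) : Finset ℕ := (range (p ^ b')).filter (fun x => x % p ^ b = η)

section broad
variable {G : Type} [AddCommGroup G] [Fintype G] [DecidableEq G]

theorem fs_split (γ : ℕ → G) (p B b b' η : ℕ) (hp : 0 < p) (hb : b ≤ b') (ψ : AddChar G ℂ) :
    fs γ (cls p B b η) ψ = ∑ z ∈ lft p b b' η, fs γ (cls p B b' z) ψ := by
  unfold fs
  rw [← Finset.sum_fiberwise_of_maps_to (s := cls p B b η) (t := lft p b b' η)
    (g := fun x => x % p ^ b')]
  · refine Finset.sum_congr rfl fun z hz => ?_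
    refine Finset.sum_congr ?_ fun _ _ => rfl
    ext x
    simp only [cls, lft, mem_filter, mem_range] at hz ⊢
    constructor
    · rintro ⟨⟨h1, h2⟩, h3⟩; exact ⟨h1, h3⟩
    · rintro ⟨h1, h3⟩
      refine ⟨⟨h1, ?_⟩, h3⟩
      rw [← hz.2, ← h3, Nat.mod_mod_of_dvd _ (pow_dvd_pow p hb)]
  · intro x hx
    simp only [cls, lft, mem_filter, mem_range] at hx ⊢
    refine ⟨Nat.mod_lt _ (by positivity), ?_⟩
    rw [Nat.mod_mod_of_dvd _ (pow_dvd_pow p hb)]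
    exact hx.2

theorem lft_card (p b b' η : ℕ) (hp : 0 < p) (hb : b ≤ b') : (lft p b b' η).card ≤ p ^ (b' - b) := by
  have hpm : 0 < p ^ b := by positivity
  rw [← Finset.card_range (p ^ (b' - b))]
  refine Finset.card_le_card_of_injOn (fun v => v / p ^ b) ?_ ?_
  · intro v hv
    simp only [lft, coe_filter, mem_range, Set.mem_ofPred_eq] at hv
    simp only [coe_range, Set.mem_Iio]
    rw [Nat.div_lt_iff_lt_mul hpm, ← pow_add, Nat.sub_add_cancel hb]
    exact hv.1
  · intro v hv w hw hvw
    simp only [lft, coe_filter, mem_range, Set.mem_ofPred_eq] at hv hw hvw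
    rw [← Nat.div_add_mod v (p ^ b), ← Nat.div_add_mod w (p ^ b), hvw, hv.2, hw.2]

theorem lft_nonempty (p b b' η : ℕ) (hp : 0 < p) (hb : b ≤ b') (hη : η < p ^ b) :
    (lft p b b' η).Nonempty := by
  refine ⟨η, ?_⟩
  simp only [lft, mem_filter, mem_range]
  exact ⟨hη.trans_le (Nat.pow_le_pow_right hp hb), Nat.mod_eq_of_lt hη⟩

theorem pw {E : Finset ℕ} (hE : E.Nonempty) (K : ℕ) (hK : 0 < K) (p : ℝ) (hp : 0 < p) (hEp : (E.card : ℝ) ≤ p)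
    (w : ℕ → ℝ) (hw : ∀ e, 0 ≤ w e) (W : ℝ) (hW0 : 0 ≤ W) (hW : W ≤ ∑ e ∈ E, w e) :
    (∃ e : Fin K → ℕ, (∀ i, e i ∈ E) ∧ Function.Injective e ∧ ∀ i, W ≤ 2 * p * w (e i)) ∨
    (∃ e ∈ E, W ≤ 2 * K * w e) := by
  classical
  set Lg := E.filter (fun e => W ≤ 2 * p * w e) with hLg
  by_cases hc : K ≤ Lg.card
  · left
    obtain ⟨S, hS, hSc⟩ := Finset.exists_subset_card_eq hc
    refine ⟨fun i => S.equivFin.symm (Fin.cast hSc.symm i), ?_, ?_, ?_⟩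
    · intro i
      exact (mem_filter.mp (hS (S.equivFin.symm (Fin.cast hSc.symm i)).2)).1
    · intro i j hij
      have := S.equivFin.symm.injective (Subtype.ext hij)
      exact Fin.cast_injective _ this
    · intro i
      exact (mem_filter.mp (hS (S.equivFin.symm (Fin.cast hSc.symm i)).2)).2
  · right
    push Not at hc
    by_contra hcon
    push Not at hcon
    have hKr : (0:ℝ) < K := by exact_mod_cast hK
    have hsplit := Finset.sum_filter_add_sum_filter_not E (fun e => W ≤ 2 * p * w e) w
    have h1 : ∑ e ∈ E.filter (fun e => ¬ (W ≤ 2 * p * w e)), w e ≤ W / 2 := by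
      calc _ ≤ ∑ e ∈ E.filter (fun e => ¬ (W ≤ 2 * p * w e)), W / (2 * p) := by
            refine Finset.sum_le_sum fun e he => ?_
            have := (mem_filter.mp he).2
            push Not at this
            rw [le_div_iff₀ (by positivity)]; linarith
        _ = ((E.filter (fun e => ¬ (W ≤ 2 * p * w e))).card : ℝ) * (W / (2 * p)) := by
            rw [sum_const, nsmul_eq_mul]
        _ ≤ p * (W / (2 * p)) := by
            gcongr
            refine le_trans ?_ hEp
            exact_mod_cast Finset.card_filter_le _ _
        _ = W / 2 := by field_simp
    obtain ⟨e0, he0⟩ := hE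
    have hWpos : 0 < W := by
      have := hcon e0 he0
      have h2 : 0 ≤ 2 * K * w e0 := mul_nonneg (by positivity) (hw e0)
      linarith
    have h2 : ∑ e ∈ Lg, w e ≤ (Lg.card : ℝ) * (W / (2 * K)) := by
      rw [← nsmul_eq_mul, ← sum_const]
      refine Finset.sum_le_sum fun e he => ?_
      have := hcon e (mem_filter.mp he).1
      rw [le_div_iff₀ (by positivity)]; linarith
    have h3 : (Lg.card : ℝ) * (W / (2 * K)) < K * (W / (2 * K)) := by
      have : (Lg.card : ℝ) < K := by exact_mod_cast hc
      have h4 : 0 < W / (2 * K) := by positivity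
      nlinarith
    have h4 : K * (W / (2 * K)) = W / 2 := by field_simp
    rw [← hLg] at hsplit
    linarith

/-- product of conditioned sums -/
noncomputable def FF (γ : ℕ → G) (p B K a : ℕ) (ξ : Fin K → ℕ) (ψ : AddChar G ℂ) : ℝ :=
  ∏ i, ‖fs γ (cls p B (a + 1) (ξ i)) ψ‖ ^ 2

theorem FF_nonneg (γ : ℕ → G) (p B K a : ℕ) (ξ : Fin K → ℕ) (ψ : AddChar G ℂ) :
    0 ≤ FF γ p B K a ξ ψ := Finset.prod_nonneg fun _ _ => by positivity

theorem broad_narrow (γ : ℕ → G) (p B K b η n : ℕ) (hp : 1 < p) (hK : 0 < K) (hn : K ≤ n)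
    (hpn : 2 * (2 * K) ^ (2 * n) ≤ p) (hη : η < p ^ b) (wt : AddChar G ℂ → ℝ) (hwt : ∀ ψ, 0 ≤ wt ψ) :
    (∃ ζ, Cond p K b η ζ ∧ ∑ ψ, wt ψ * ‖fs γ (cls p B b η) ψ‖ ^ (2 * n) ≤
      (p : ℝ) ^ (5 * K + 1) * ∑ ψ, wt ψ * (FF γ p B K b ζ ψ * ‖fs γ (cls p B b η) ψ‖ ^ (2 * n - 2 * K))) ∨
    (∃ η', η' < p ^ (b + 1) ∧ η' % p ^ b = η ∧ ∑ ψ, wt ψ * ‖fs γ (cls p B b η) ψ‖ ^ (2 * n) ≤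
      (p : ℝ) ^ 2 * ∑ ψ, wt ψ * ‖fs γ (cls p B (b + 1) η') ψ‖ ^ (2 * n)) := by
  classical
  by_contra hcon
  push Not at hcon
  obtain ⟨hc1, hc2⟩ := hcon
  set S := ∑ ψ, wt ψ * ‖fs γ (cls p B b η) ψ‖ ^ (2 * n) with hS
  have hp0 : 0 < p := by omega
  set E := lft p b (b + 1) η with hE
  have hEne : E.Nonempty := lft_nonempty p b (b + 1) η hp0 (by omega) hη
  have hEcard : E.card ≤ p := by simpa using lft_card p b (b + 1) η hp0 (by omega)
  set T := (Fintype.piFinset (fun _ : Fin K => E)).filter Function.Injective with hT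
  have hTcard : T.card ≤ p ^ K := by
    refine (Finset.card_filter_le _ _).trans ?_
    rw [Fintype.card_piFinset_const]
    simpa using Nat.pow_le_pow_left hEcard K
  have hpr : (1 : ℝ) < p := by exact_mod_cast hp
  have hp2 : (2 : ℝ) ≤ p := by exact_mod_cast hp
  have hpt : ∀ ψ, wt ψ * ‖fs γ (cls p B b η) ψ‖ ^ (2 * n) ≤
      (∑ ζ ∈ T, (2 * (p : ℝ)) ^ (2 * K) *
        (wt ψ * (FF γ p B K b ζ ψ * ‖fs γ (cls p B b η) ψ‖ ^ (2 * n - 2 * K)))) +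
      ∑ e ∈ E, (2 * (K : ℝ)) ^ (2 * n) * (wt ψ * ‖fs γ (cls p B (b + 1) e) ψ‖ ^ (2 * n)) := by
    intro ψ
    have n1 : ∀ ζ ∈ T, 0 ≤ (2 * (p : ℝ)) ^ (2 * K) *
        (wt ψ * (FF γ p B K b ζ ψ * ‖fs γ (cls p B b η) ψ‖ ^ (2 * n - 2 * K))) := fun ζ _ =>
      mul_nonneg (by positivity) (mul_nonneg (hwt ψ) (mul_nonneg (FF_nonneg ..) (by positivity)))
    have n2 : ∀ e ∈ E, 0 ≤ (2 * (K : ℝ)) ^ (2 * n) * (wt ψ * ‖fs γ (cls p B (b + 1) e) ψ‖ ^ (2 * n)) :=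
      fun e _ => mul_nonneg (by positivity) (mul_nonneg (hwt ψ) (by positivity))
    have hWle : ‖fs γ (cls p B b η) ψ‖ ≤ ∑ e ∈ E, ‖fs γ (cls p B (b + 1) e) ψ‖ := by
      rw [fs_split γ p B b (b + 1) η hp0 (by omega)]
      exact norm_sum_le _ _
    rcases pw hEne K hK p (by linarith) (by exact_mod_cast hEcard)
      (fun e => ‖fs γ (cls p B (b + 1) e) ψ‖) (fun _ => norm_nonneg _) _ (norm_nonneg _) hWle with
      ⟨ζ, hζE, hζi, hζ⟩ | ⟨e, heE, he⟩
    · have hζT : ζ ∈ T := by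
        rw [hT, mem_filter]; exact ⟨Fintype.mem_piFinset.mpr hζE, hζi⟩
      have := Finset.single_le_sum n1 hζT
      have h2 := Finset.sum_nonneg n2
      refine le_trans ?_ (add_le_add this h2)
      rw [add_zero, ← mul_assoc, mul_comm ((2 * (p:ℝ)) ^ (2 * K)) (wt ψ), mul_assoc]
      refine mul_le_mul_of_nonneg_left ?_ (hwt ψ)
      rw [← mul_assoc]
      have e1 : 2 * n = 2 * K + (2 * n - 2 * K) := by omega
      conv_lhs => rw [e1, pow_add]
      refine mul_le_mul_of_nonneg_right ?_ (by positivity)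
      unfold FF
      rw [pow_mul, pow_mul]
      have : ∏ _i : Fin K, ‖fs γ (cls p B b η) ψ‖ ^ 2 ≤
          ∏ i : Fin K, (2 * (p : ℝ)) ^ 2 * ‖fs γ (cls p B (b + 1) (ζ i)) ψ‖ ^ 2 := by
        refine Finset.prod_le_prod (fun _ _ => by positivity) fun i _ => ?_
        rw [← mul_pow]
        exact pow_le_pow_left₀ (norm_nonneg _) (hζ i) 2
      rw [Finset.prod_mul_distrib] at this
      simpa using this
    · have := Finset.single_le_sum n2 heE
      have h2 := Finset.sum_nonneg n1
      refine le_trans ?_ (add_le_add h2 this)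
      rw [zero_add, ← mul_assoc, mul_comm ((2 * (K:ℝ)) ^ (2 * n)) (wt ψ), mul_assoc]
      refine mul_le_mul_of_nonneg_left ?_ (hwt ψ)
      rw [← mul_pow]
      exact pow_le_pow_left₀ (norm_nonneg _) he _
  have hsum := Finset.sum_le_sum (s := univ) (fun ψ _ => hpt ψ)
  rw [← hS, Finset.sum_add_distrib, Finset.sum_comm, Finset.sum_comm (s := univ) (t := E)] at hsum
  simp_rw [← Finset.mul_sum] at hsum
  have hppos : (0 : ℝ) < p := by linarith
  have hS0 : 0 ≤ S := Finset.sum_nonneg fun ψ _ => mul_nonneg (hwt ψ) (by positivity)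
  have hX : (2 * (p : ℝ)) ^ (2 * K) * ∑ ζ ∈ T, ∑ ψ, wt ψ * (FF γ p B K b ζ ψ * ‖fs γ (cls p B b η) ψ‖ ^ (2 * n - 2 * K))
      ≤ S / 2 := by
    have h1 : ∑ ζ ∈ T, ∑ ψ, wt ψ * (FF γ p B K b ζ ψ * ‖fs γ (cls p B b η) ψ‖ ^ (2 * n - 2 * K)) ≤
        ∑ ζ ∈ T, S / (p : ℝ) ^ (5 * K + 1) := by
      refine Finset.sum_le_sum fun ζ hζ => ?_
      rw [hT, mem_filter, Fintype.mem_piFinset] at hζ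
      have := hc1 ζ ⟨fun i => ?_, fun i => ?_, hζ.2⟩
      · rw [le_div_iff₀ (by positivity)]; linarith
      · have := hζ.1 i; rw [hE, lft, mem_filter, mem_range] at this; exact this.1
      · have := hζ.1 i; rw [hE, lft, mem_filter, mem_range] at this; exact this.2
    rw [sum_const, nsmul_eq_mul] at h1
    have h2 : (T.card : ℝ) * (S / (p : ℝ) ^ (5 * K + 1)) ≤ (p : ℝ) ^ K * (S / (p : ℝ) ^ (5 * K + 1)) := by
      gcongr; exact_mod_cast hTcard
    calc _ ≤ (2 * (p : ℝ)) ^ (2 * K) * ((p : ℝ) ^ K * (S / (p : ℝ) ^ (5 * K + 1))) := by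
          gcongr; exact h1.trans h2
      _ ≤ ((p:ℝ) * (p : ℝ)) ^ (2 * K) * ((p : ℝ) ^ K * (S / (p : ℝ) ^ (5 * K + 1))) := by
          gcongr
      _ = S / p := by
          field_simp
          ring
      _ ≤ S / 2 := by gcongr
  have hY : (2 * (K : ℝ)) ^ (2 * n) * ∑ e ∈ E, ∑ ψ, wt ψ * ‖fs γ (cls p B (b + 1) e) ψ‖ ^ (2 * n) < S / 2 := by
    have h1 : ∑ e ∈ E, ∑ ψ, wt ψ * ‖fs γ (cls p B (b + 1) e) ψ‖ ^ (2 * n) < ∑ e ∈ E, S / (p : ℝ) ^ 2 := by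
      refine Finset.sum_lt_sum_of_nonempty hEne fun e he => ?_
      rw [hE, lft, mem_filter, mem_range] at he
      have := hc2 e he.1 he.2
      rw [lt_div_iff₀ (by positivity)]; linarith
    rw [sum_const, nsmul_eq_mul] at h1
    have h2 : (E.card : ℝ) * (S / (p : ℝ) ^ 2) ≤ (p : ℝ) * (S / (p : ℝ) ^ 2) := by
      gcongr
    have hKr : (0 : ℝ) < K := by exact_mod_cast hK
    have hpn' : 2 * (2 * (K:ℝ)) ^ (2 * n) ≤ p := by exact_mod_cast hpn
    calc _ < (2 * (K : ℝ)) ^ (2 * n) * ((p : ℝ) * (S / (p : ℝ) ^ 2)) := by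
          have h3 := h1.trans_le h2
          have : 0 < (2 * (K : ℝ)) ^ (2 * n) := by positivity
          exact mul_lt_mul_of_pos_left h3 this
      _ = (2 * (2 * (K:ℝ)) ^ (2 * n)) * (S / (2 * p)) := by field_simp
      _ ≤ p * (S / (2 * p)) := by gcongr
      _ = S / 2 := by field_simp
  linarith
end broad
end EC


set_option linter.unusedSectionVars false
namespace EC
open Finset

/-- the moment curve modulo N -/
def gam (K N : ℕ) (x : ℕ) : Fin K → ZMod N := fun j => (x : ZMod N) ^ ((j : ℕ) + 1)

theorem nowrap {ι : Type} [Fintype ι] (p K t B N : ℕ) (hN : N = t * p ^ (B * K) + 1) (hp : 0 < p) (hι : Fintype.card ι ≤ t) (x y : ι → ℕ)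
    (hx : ∀ i, x i < p ^ B) (hy : ∀ i, y i < p ^ B)
    (h : ∑ i, gam K N (x i) = ∑ i, gam K N (y i)) :
    ∀ j < K, ∑ i, x i ^ (j + 1) = ∑ i, y i ^ (j + 1) := by
  intro j hj
  have h1 := congrFun h ⟨j, hj⟩
  simp only [Finset.sum_apply, gam] at h1
  have bd : ∀ z : ι → ℕ, (∀ i, z i < p ^ B) → ∑ i, z i ^ (j + 1) < N := by
    intro z hz
    have : ∑ i, z i ^ (j + 1) ≤ ∑ _i : ι, p ^ (B * K) := by
      refine Finset.sum_le_sum fun i _ => ?_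
      calc z i ^ (j + 1) ≤ (p ^ B) ^ (j + 1) := Nat.pow_le_pow_left (hz i).le _
        _ = p ^ (B * (j + 1)) := by rw [pow_mul]
        _ ≤ p ^ (B * K) := Nat.pow_le_pow_right hp (Nat.mul_le_mul_left B hj)
    rw [sum_const, smul_eq_mul, card_univ] at this
    have h3 := Nat.mul_le_mul_right (p ^ (B * K)) hι
    omega
  have h2 : ((∑ i, x i ^ (j + 1) : ℕ) : ZMod N) = ((∑ i, y i ^ (j + 1) : ℕ) : ZMod N) := by
    push_cast; exact h1
  rw [ZMod.natCast_eq_natCast_iff'] at h2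
  rwa [Nat.mod_eq_of_lt (bd x hx), Nat.mod_eq_of_lt (bd y hy)] at h2

section step
variable (p K t B N : ℕ) [NeZero N]

theorem norm_prod_fs {G : Type} [AddCommGroup G] [Fintype G] [DecidableEq G] {ι : Type} [Fintype ι] [DecidableEq ι]
    (γ : ℕ → G) (A : ι → Finset ℕ) (ψ : AddChar G ℂ) :
    ‖∑ x ∈ Fintype.piFinset A, ψ (∑ i, γ (x i))‖ ^ 2 = ∏ i, ‖fs γ (A i) ψ‖ ^ 2 := by
  rw [← prod_fs, norm_prod, Finset.prod_pow]

theorem hyp_aux (hN : N = t * p ^ (B * K) + 1) (hp : 0 < p) (b b' η m : ℕ) (hm : K + K + m ≤ t)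
    (x x' : Fin K → ℕ) (y y' : Fin K ⊕ Fin m → ℕ)
    (hx : ∀ i, x i < p ^ B) (hx' : ∀ i, x' i < p ^ B)
    (hy : ∀ i, y i < p ^ B) (hy' : ∀ i, y' i < p ^ B)
    (hyη : ∀ i, y i % p ^ b = η) (hyη' : ∀ i, y' i % p ^ b = η)
    (h : ∑ i, gam K N (x i) + ∑ i, gam K N (y i) =
      ∑ i, gam K N (x' i) + ∑ i, gam K N (y' i)) :
    rr p K b b' η (fun i => x i % p ^ b') = rr p K b b' η (fun i => x' i % p ^ b') := by
  have h0 := nowrap (ι := Fin K ⊕ (Fin K ⊕ Fin m)) p K t B N hN hp (by simp; omega)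
    (Sum.elim x y) (Sum.elim x' y') (by rintro (i | i); exacts [hx i, hy i])
    (by rintro (i | i); exacts [hx' i, hy' i])
    (by rw [Fintype.sum_sum_type, Fintype.sum_sum_type (fun i => gam K N (Sum.elim x' y' i))]; simpa only [Sum.elim_inl, Sum.elim_inr] using h)
  have h1 := shift (ι := Fin K ⊕ (Fin K ⊕ Fin m)) 0 0 (η : ℤ) K (fun i => ((Sum.elim x y i : ℕ) : ℤ))
    (fun i => ((Sum.elim x' y' i : ℕ) : ℤ)) (by
      intro j hj
      have := h0 j hj
      rw [Int.modEq_zero_iff]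
      simp only [sub_zero]
      exact_mod_cast this)
  funext j
  have h2 := h1 j j.2
  rw [Int.modEq_zero_iff, Fintype.sum_sum_type, Fintype.sum_sum_type (fun i => (((Sum.elim x' y' i : ℕ) : ℤ) - (η:ℤ)) ^ ((j:ℕ) + 1))] at h2
  simp only [Sum.elim_inl, Sum.elim_inr] at h2
  set q := (p : ℤ) ^ (min (((j : ℕ) + 1) * b) b') with hq
  have hq1 : q ∣ (p : ℤ) ^ b' := pow_dvd_pow _ (min_le_right _ _)
  have hq2 : q ∣ (p : ℤ) ^ (((j : ℕ) + 1) * b) := pow_dvd_pow _ (min_le_left _ _)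
  have hyz : ∀ y : Fin K ⊕ Fin m → ℕ, (∀ i, y i % p ^ b = η) →
      ∑ i, ((y i : ℤ) - η) ^ ((j : ℕ) + 1) ≡ 0 [ZMOD q] := by
    intro y hy
    rw [Int.modEq_zero_iff_dvd]
    refine Finset.dvd_sum fun i _ => hq2.trans ?_
    rw [mul_comm, pow_mul]
    refine pow_dvd_pow_of_dvd ?_ _
    have := Nat.div_add_mod (y i) (p ^ b)
    rw [hy i] at this
    refine ⟨((y i / p ^ b : ℕ) : ℤ), ?_⟩
    have h3 : (y i : ℤ) = (p : ℤ) ^ b * ((y i / p ^ b : ℕ) : ℤ) + η := by exact_mod_cast this.symm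
    linarith
  have hxz : ∀ x : Fin K → ℕ, ∑ i, (((x i % p ^ b' : ℕ) : ℤ) - η) ^ ((j : ℕ) + 1) ≡
      ∑ i, ((x i : ℤ) - η) ^ ((j : ℕ) + 1) [ZMOD q] := by
    intro x
    refine Int.ModEq.sum fun i _ => Int.ModEq.pow _ (Int.ModEq.sub_right _ ?_)
    refine Int.ModEq.of_dvd hq1 ?_
    push_cast
    exact Int.mod_modEq _ _
  show _ % q = _ % q
  change _ ≡ _ [ZMOD q]
  refine (hxz x).trans (Int.ModEq.trans ?_ (hxz x').symm)
  have h5 : ∑ i, ((x i : ℤ) - η) ^ ((j : ℕ) + 1) + ∑ i, ((y i : ℤ) - η) ^ ((j : ℕ) + 1) ≡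
    ∑ i, ((x' i : ℤ) - η) ^ ((j : ℕ) + 1) + ∑ i, ((y' i : ℤ) - η) ^ ((j : ℕ) + 1) [ZMOD q] := by
    have := h2
    exact congrArg (· % q) this
  have h6 := (hyz y hyη).trans (hyz y' hyη').symm
  exact Int.ModEq.add_right_cancel h6 h5

theorem congr_step (hN : N = t * p ^ (B * K) + 1) [Fact p.Prime] (hKp : K < p) (a b b' η ξ0 m : ℕ) (hm : K + K + m ≤ t) (ξ ζ : Fin K → ℕ)
    (hξ : Cond p K a ξ0 ξ) (hζ : Cond p K b η ζ) (hab : a + 1 ≤ b') :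
    ∑ ψ, FF (gam K N) p B K a ξ ψ *
      (FF (gam K N) p B K b ζ ψ * ‖fs (gam K N) (cls p B b η) ψ‖ ^ (2 * m)) ≤
    (p : ℝ) ^ (∑ j : Fin K, (b' - ((j : ℕ) + 1) * b) + ∑ j : Fin K, (j : ℕ) * a) *
    ∑ ψ, (∏ i, ∑ z ∈ lft p (a + 1) b' (ξ i), ‖fs (gam K N) (cls p B b' z) ψ‖ ^ 2) *
      (FF (gam K N) p B K b ζ ψ * ‖fs (gam K N) (cls p B b η) ψ‖ ^ (2 * m)) := by
  classical
  set C := ∑ j : Fin K, (b' - ((j : ℕ) + 1) * b) + ∑ j : Fin K, (j : ℕ) * a with hC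
  have hp0 : 0 < p := (Fact.out : p.Prime).pos
  set γ := gam K N with hγ
  set X := Fintype.piFinset (fun i : Fin K => cls p B (a + 1) (ξ i)) with hX
  set A : Fin K ⊕ Fin m → Finset ℕ := Sum.elim (fun i => cls p B (b + 1) (ζ i)) (fun _ => cls p B b η) with hA
  set Y := Fintype.piFinset A with hY
  let r : (Fin K → ℕ) → (Fin K → ℤ) := fun x => rr p K b b' η (fun i => x i % p ^ b')
  have eX : ∀ ψ, FF γ p B K a ξ ψ = ‖∑ x ∈ X, ψ (∑ i, γ (x i))‖ ^ 2 := by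
    intro ψ; rw [norm_prod_fs]; rfl
  have eY : ∀ ψ, FF γ p B K b ζ ψ * ‖fs γ (cls p B b η) ψ‖ ^ (2 * m) = ‖∑ y ∈ Y, ψ (∑ i, γ (y i))‖ ^ 2 := by
    intro ψ; rw [norm_prod_fs, Fintype.prod_sum_type]
    simp only [hA, Sum.elim_inl, Sum.elim_inr, Finset.prod_const, card_univ, Fintype.card_fin]
    rw [pow_mul]; rfl
  simp_rw [eX, eY]
  have hAη : ∀ y ∈ Y, ∀ i, y i < p ^ B ∧ y i % p ^ b = η := by
    intro y hy i
    have := Fintype.mem_piFinset.mp hy i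
    rcases i with i | i
    · simp only [hA, Sum.elim_inl, cls, mem_filter, mem_range] at this
      refine ⟨this.1, ?_⟩
      have h2 := hζ.2.1 i
      rw [← h2, ← this.2, Nat.mod_mod_of_dvd _ (pow_dvd_pow p (Nat.le_succ b))]
    · simp only [hA, Sum.elim_inr, cls, mem_filter, mem_range] at this
      exact this
  refine (orth X Y (fun x => ∑ i, γ (x i)) (fun y => ∑ i, γ (y i)) r ?_).trans ?_
  · intro x hx x' hx' y hy y' hy' he
    have hxb : ∀ x ∈ X, ∀ i, x i < p ^ B := by
      intro x hx i
      have := Fintype.mem_piFinset.mp hx i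
      simp only [cls, mem_filter, mem_range] at this
      exact this.1
    exact hyp_aux p K t B N hN hp0 b b' η m hm x x' y y' (hxb x hx) (hxb x' hx')
      (fun i => (hAη y hy i).1) (fun i => (hAη y' hy' i).1) (fun i => (hAη y hy i).2) (fun i => (hAη y' hy' i).2) he
  -- pointwise on the fibers
  have hfib : ∀ R ψ, ‖∑ x ∈ X.filter (fun x => r x = R), ψ (∑ i, γ (x i))‖ ^ 2 ≤
      (p : ℝ) ^ C * ∑ z ∈ (ZZ p K a b' ξ).filter (fun z => rr p K b b' η z = R), ∏ i, ‖fs γ (cls p B b' (z i)) ψ‖ ^ 2 := by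
    intro R ψ
    have e1 : ∑ x ∈ X.filter (fun x => r x = R), ψ (∑ i, γ (x i)) =
        ∑ z ∈ (ZZ p K a b' ξ).filter (fun z => rr p K b b' η z = R), ∏ i, fs γ (cls p B b' (z i)) ψ := by
      rw [← Finset.sum_fiberwise_of_maps_to (s := X.filter (fun x => r x = R))
        (t := (ZZ p K a b' ξ).filter (fun z => rr p K b b' η z = R)) (g := fun x i => x i % p ^ b')]
      · refine Finset.sum_congr rfl fun z hz => ?_
        rw [prod_fs]
        refine Finset.sum_congr ?_ fun _ _ => rfl
        ext x
        simp only [hX, mem_filter, Fintype.mem_piFinset, cls, mem_range, ZZ] at hz ⊢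
        constructor
        · rintro ⟨⟨h1, h2⟩, h3⟩ i
          exact ⟨(h1 i).1, congrFun h3 i⟩
        · intro h1
          have h3 : (fun i => x i % p ^ b') = z := funext fun i => (h1 i).2
          refine ⟨⟨fun i => ⟨(h1 i).1, ?_⟩, ?_⟩, h3⟩
          · have h4 := (hz.1 i).2
            rw [← h4, ← (h1 i).2, Nat.mod_mod_of_dvd _ (pow_dvd_pow p hab)]
          · show rr p K b b' η (fun i => x i % p ^ b') = R
            rw [h3]; exact hz.2
      · intro x hx
        simp only [hX, mem_filter, Fintype.mem_piFinset, cls, mem_range, ZZ] at hx ⊢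
        refine ⟨fun i => ⟨Nat.mod_lt _ (by positivity), ?_⟩, hx.2⟩
        rw [Nat.mod_mod_of_dvd _ (pow_dvd_pow p hab)]
        exact (hx.1 i).2
    rw [e1]
    set Φ := (ZZ p K a b' ξ).filter (fun z => rr p K b b' η z = R) with hΦ
    have hcard : (Φ.card : ℝ) ≤ (p : ℝ) ^ C := by
      exact_mod_cast fiber_card p K a b b' η ξ0 hKp ξ hξ (by omega) R
    calc _ ≤ (∑ z ∈ Φ, ‖∏ i, fs γ (cls p B b' (z i)) ψ‖) ^ 2 := by
          gcongr; exact norm_sum_le _ _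
      _ ≤ Φ.card * ∑ z ∈ Φ, ‖∏ i, fs γ (cls p B b' (z i)) ψ‖ ^ 2 := sq_sum_le_card_mul_sum_sq
      _ ≤ (p : ℝ) ^ C * ∑ z ∈ Φ, ‖∏ i, fs γ (cls p B b' (z i)) ψ‖ ^ 2 := by
          gcongr
      _ = _ := by
          congr 1
          refine Finset.sum_congr rfl fun z _ => ?_
          rw [norm_prod, Finset.prod_pow]
  rw [Finset.sum_comm, Finset.mul_sum]
  refine Finset.sum_le_sum fun ψ _ => ?_
  rw [← Finset.sum_mul, ← mul_assoc]
  refine mul_le_mul_of_nonneg_right ?_ (by positivity)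
  calc _ ≤ ∑ R ∈ X.image r, (p : ℝ) ^ C * ∑ z ∈ (ZZ p K a b' ξ).filter (fun z => rr p K b b' η z = R),
        ∏ i, ‖fs γ (cls p B b' (z i)) ψ‖ ^ 2 := Finset.sum_le_sum fun R _ => hfib R ψ
    _ = (p : ℝ) ^ C * ∑ R ∈ X.image r, ∑ z ∈ (ZZ p K a b' ξ).filter (fun z => rr p K b b' η z = R),
        ∏ i, ‖fs γ (cls p B b' (z i)) ψ‖ ^ 2 := by rw [Finset.mul_sum]
    _ ≤ (p : ℝ) ^ C * ∑ z ∈ ZZ p K a b' ξ, ∏ i, ‖fs γ (cls p B b' (z i)) ψ‖ ^ 2 := by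
        gcongr
        exact Finset.sum_fiberwise_le_sum_of_sum_fiber_nonneg (fun R _ =>
          Finset.sum_nonneg fun z _ => Finset.prod_nonneg fun _ _ => by positivity)
    _ = _ := by
        rw [Finset.prod_univ_sum]; rfl
end step
end EC


set_option linter.unusedSectionVars false
namespace EC
open Finset

section hold
variable {G : Type} [AddCommGroup G] [Fintype G] [DecidableEq G]

/-- mixed moments are dominated by pure ones -/
theorem FF_mean (γ : ℕ → G) (p B K b η s : ℕ) (ζ : Fin K → ℕ) (hζ : Cond p K b η ζ) :
    ∑ ψ, FF γ p B K b ζ ψ * ‖fs γ (cls p B b η) ψ‖ ^ (2 * s) ≤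
      ∑ ψ, ‖fs γ (cls p B b η) ψ‖ ^ (2 * (s + K)) := by
  have := mean_mono (ι := Fin K ⊕ Fin s) γ
    (A := Sum.elim (fun i => cls p B (b + 1) (ζ i)) (fun _ => cls p B b η))
    (A' := fun _ => cls p B b η) (by
      rintro (i | i)
      · intro x hx
        simp only [Sum.elim_inl, cls, mem_filter, mem_range] at hx ⊢
        refine ⟨hx.1, ?_⟩
        rw [← hζ.2.1 i, ← hx.2, Nat.mod_mod_of_dvd _ (pow_dvd_pow p (Nat.le_succ b))]
      · exact Finset.Subset.refl _)
  refine (le_of_eq ?_).trans (this.trans (le_of_eq ?_))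
  · refine Finset.sum_congr rfl fun ψ _ => ?_
    rw [Fintype.prod_sum_type]
    simp only [Sum.elim_inl, Sum.elim_inr, Finset.prod_const, card_univ, Fintype.card_fin]
    rw [pow_mul]; rfl
  · refine Finset.sum_congr rfl fun ψ _ => ?_
    simp only [Finset.prod_const, card_univ, Fintype.card_sum, Fintype.card_fin]
    rw [pow_mul, add_comm K s]

theorem pw_holder (K s : ℕ) (hK : 0 < K) (hs : 0 < s) (S : Fin K → ℝ) (hS : ∀ i, 0 ≤ S i) :
    ∏ i, S i ≤ (∑ i, S i ^ s) ^ ((K : ℝ) / s) := by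
  have hT : 0 ≤ ∑ i, S i ^ s := Finset.sum_nonneg fun i _ => pow_nonneg (hS i) _
  have hs' : (s : ℝ) ≠ 0 := by positivity
  have h1 : ∀ i, S i ≤ (∑ i, S i ^ s) ^ ((1 : ℝ) / s) := by
    intro i
    calc S i = (S i ^ s) ^ ((1 : ℝ) / s) := by
          rw [← Real.rpow_natCast, ← Real.rpow_mul (hS i), mul_one_div_cancel hs', Real.rpow_one]
      _ ≤ _ := by
          refine Real.rpow_le_rpow (pow_nonneg (hS i) _) ?_ (by positivity)
          exact Finset.single_le_sum (f := fun i => S i ^ s) (fun i _ => pow_nonneg (hS i) _) (mem_univ i)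
  calc ∏ i, S i ≤ ∏ _i : Fin K, (∑ i, S i ^ s) ^ ((1 : ℝ) / s) :=
        Finset.prod_le_prod (fun i _ => hS i) fun i _ => h1 i
    _ = _ := by
        rw [Finset.prod_const, card_univ, Fintype.card_fin, ← Real.rpow_natCast, ← Real.rpow_mul hT]
        congr 1; ring

theorem holder_step (γ : ℕ → G) (p B K a b b' η s : ℕ) (hp : 0 < p) (hK : 0 < K) (hKp : K ≤ p) (hKs : K < s)
    (ξ ζ : Fin K → ℕ) (hζ : Cond p K b η ζ) (hab : a + 1 ≤ b') (Q : ℝ)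
    (hQ : ∀ z < p ^ b', ∑ ψ, FF γ p B K b ζ ψ * ‖fs γ (cls p B b' z) ψ‖ ^ (2 * s) ≤ Q) :
    ∑ ψ, (∏ i, ∑ z ∈ lft p (a + 1) b' (ξ i), ‖fs γ (cls p B b' z) ψ‖ ^ 2) *
      (FF γ p B K b ζ ψ * ‖fs γ (cls p B b η) ψ‖ ^ (2 * (s - K))) ≤
    ((p : ℝ) ^ ((b' - a) * s) * Q) ^ ((K : ℝ) / s) *
      (∑ ψ, ‖fs γ (cls p B b η) ψ‖ ^ (2 * (s + K))) ^ (1 - (K : ℝ) / s) := by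
  have hs0 : 0 < s := by omega
  have hsr : (0 : ℝ) < s := by exact_mod_cast hs0
  have hKr : (0 : ℝ) < K := by exact_mod_cast hK
  have hpr : (1 : ℝ) ≤ p := by exact_mod_cast hp
  set θ : ℝ := (K : ℝ) / s with hθ
  have hθ0 : 0 < θ := by positivity
  have hθ1 : θ < 1 := by rw [hθ, div_lt_one hsr]; exact_mod_cast hKs
  let u : AddChar G ℂ → ℝ := fun ψ => ∑ i, ((p : ℝ) ^ (b' - a)) ^ (s - 1) *
    ∑ z ∈ lft p (a + 1) b' (ξ i), ‖fs γ (cls p B b' z) ψ‖ ^ (2 * s)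
  have hu0 : ∀ ψ, 0 ≤ u ψ := fun ψ => Finset.sum_nonneg fun i _ => mul_nonneg (by positivity)
    (Finset.sum_nonneg fun z _ => by positivity)
  have hcard : ∀ i, ((lft p (a + 1) b' (ξ i)).card : ℝ) ≤ (p : ℝ) ^ (b' - a - 1) := by
    intro i
    have := lft_card p (a + 1) b' (ξ i) hp hab
    rw [Nat.sub_sub]
    exact_mod_cast this
  have h1 : ∀ ψ, ∏ i, ∑ z ∈ lft p (a + 1) b' (ξ i), ‖fs γ (cls p B b' z) ψ‖ ^ 2 ≤ u ψ ^ θ := by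
    intro ψ
    refine (pw_holder K s hK hs0 _ (fun i => Finset.sum_nonneg fun z _ => by positivity)).trans ?_
    refine Real.rpow_le_rpow (Finset.sum_nonneg fun i _ => pow_nonneg (Finset.sum_nonneg fun z _ => by positivity) _) ?_ hθ0.le
    refine Finset.sum_le_sum fun i _ => ?_
    obtain ⟨n, rfl⟩ : ∃ n, s = n + 1 := ⟨s - 1, by omega⟩
    have h3 : (∑ z ∈ lft p (a + 1) b' (ξ i), ‖fs γ (cls p B b' z) ψ‖ ^ 2) ^ (n + 1) ≤
        ((lft p (a + 1) b' (ξ i)).card : ℝ) ^ n * ∑ z ∈ lft p (a + 1) b' (ξ i), (‖fs γ (cls p B b' z) ψ‖ ^ 2) ^ (n + 1) :=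
      pow_sum_le_card_mul_sum_pow (fun z _ => by positivity) n
    refine h3.trans ?_
    simp only [← pow_mul, Nat.add_sub_cancel]
    have h4 : ((lft p (a + 1) b' (ξ i)).card : ℝ) ^ n ≤ (p : ℝ) ^ ((b' - a) * n) := by
      rw [pow_mul]
      refine pow_le_pow_left₀ (by positivity) ((hcard i).trans ?_) n
      exact pow_le_pow_right₀ hpr (by omega)
    exact mul_le_mul_of_nonneg_right h4 (Finset.sum_nonneg fun z _ => by positivity)
  have h2 : ∑ ψ, (∏ i, ∑ z ∈ lft p (a + 1) b' (ξ i), ‖fs γ (cls p B b' z) ψ‖ ^ 2) *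
      (FF γ p B K b ζ ψ * ‖fs γ (cls p B b η) ψ‖ ^ (2 * (s - K))) ≤
      ∑ ψ, (u ψ * FF γ p B K b ζ ψ) ^ θ * (FF γ p B K b ζ ψ * ‖fs γ (cls p B b η) ψ‖ ^ (2 * s)) ^ (1 - θ) := by
    refine Finset.sum_le_sum fun ψ _ => ?_
    have hF := FF_nonneg γ p B K b ζ ψ
    refine (mul_le_mul_of_nonneg_right (h1 ψ) (mul_nonneg hF (by positivity))).trans (le_of_eq ?_)
    rw [Real.mul_rpow (hu0 ψ) hF, Real.mul_rpow hF (by positivity)]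
    have e1 : FF γ p B K b ζ ψ = FF γ p B K b ζ ψ ^ θ * FF γ p B K b ζ ψ ^ (1 - θ) := by
      rcases hF.eq_or_lt with h | h
      · rw [← h, Real.zero_rpow hθ0.ne', zero_mul]
      · rw [← Real.rpow_add h]; simp
    have e2 : ‖fs γ (cls p B b η) ψ‖ ^ (2 * (s - K)) = (‖fs γ (cls p B b η) ψ‖ ^ (2 * s)) ^ (1 - θ) := by
      rw [← Real.rpow_natCast, ← Real.rpow_natCast, ← Real.rpow_mul (norm_nonneg _)]
      congr 1
      push_cast [Nat.cast_sub hKs.le]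
      rw [hθ]; field_simp
    rw [e2]
    conv_lhs => rw [e1]
    ring
  refine h2.trans ((holder univ _ _ θ hθ0 hθ1 (fun ψ _ => mul_nonneg (hu0 ψ) (FF_nonneg ..))
    (fun ψ _ => mul_nonneg (FF_nonneg ..) (by positivity))).trans ?_)
  have h3 : ∑ ψ, u ψ * FF γ p B K b ζ ψ ≤ (p : ℝ) ^ ((b' - a) * s) * Q := by
    have hQ0 : 0 ≤ Q := by
      refine le_trans ?_ (hQ 0 (by positivity))
      exact Finset.sum_nonneg fun ψ _ => mul_nonneg (FF_nonneg ..) (by positivity)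
    have e1 : ∑ ψ, u ψ * FF γ p B K b ζ ψ = ∑ i, ((p : ℝ) ^ (b' - a)) ^ (s - 1) *
        ∑ z ∈ lft p (a + 1) b' (ξ i), ∑ ψ, FF γ p B K b ζ ψ * ‖fs γ (cls p B b' z) ψ‖ ^ (2 * s) := by
      simp only [u, Finset.sum_mul, Finset.mul_sum]
      rw [Finset.sum_comm]
      refine Finset.sum_congr rfl fun i _ => ?_
      rw [Finset.sum_comm]
      refine Finset.sum_congr rfl fun z _ => Finset.sum_congr rfl fun ψ _ => by ring
    rw [e1]
    calc _ ≤ ∑ i : Fin K, ((p : ℝ) ^ (b' - a)) ^ (s - 1) * ((p : ℝ) ^ (b' - a - 1) * Q) := by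
          refine Finset.sum_le_sum fun i _ => ?_
          refine mul_le_mul_of_nonneg_left ?_ (by positivity)
          calc _ ≤ ∑ z ∈ lft p (a + 1) b' (ξ i), Q := by
                refine Finset.sum_le_sum fun z hz => hQ z ?_
                simp only [lft, mem_filter, mem_range] at hz; exact hz.1
            _ = ((lft p (a + 1) b' (ξ i)).card : ℝ) * Q := by rw [sum_const, nsmul_eq_mul]
            _ ≤ _ := by gcongr; exact hcard i
      _ = K * (((p : ℝ) ^ (b' - a)) ^ (s - 1) * ((p : ℝ) ^ (b' - a - 1) * Q)) := by simp
      _ ≤ p * (((p : ℝ) ^ (b' - a)) ^ (s - 1) * ((p : ℝ) ^ (b' - a - 1) * Q)) := by gcongr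
      _ = (p : ℝ) ^ ((b' - a) * s) * Q := by
          obtain ⟨n, rfl⟩ : ∃ n, s = n + 1 := ⟨s - 1, by omega⟩
          obtain ⟨d, hd⟩ : ∃ d, b' - a = d + 1 := ⟨b' - a - 1, by omega⟩
          rw [hd]; simp only [Nat.add_sub_cancel]; ring
  refine mul_le_mul ?_ ?_ (Real.rpow_nonneg (Finset.sum_nonneg fun ψ _ => mul_nonneg (FF_nonneg ..) (by positivity)) _)
    (Real.rpow_nonneg (le_trans (Finset.sum_nonneg fun ψ _ => mul_nonneg (hu0 ψ) (FF_nonneg ..)) h3) _)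
  · exact Real.rpow_le_rpow (Finset.sum_nonneg fun ψ _ => mul_nonneg (hu0 ψ) (FF_nonneg ..)) h3 hθ0.le
  · exact Real.rpow_le_rpow (Finset.sum_nonneg fun ψ _ => mul_nonneg (FF_nonneg ..) (by positivity))
      (FF_mean γ p B K b η s ζ hζ) (by linarith)

/-- trivial bound -/
theorem triv_bound (γ : ℕ → G) (p B K a b η s : ℕ) (hK : 0 < K) (hs : 0 < s) (ξ : Fin K → ℕ) :
    ∑ ψ, FF γ p B K a ξ ψ * ‖fs γ (cls p B b η) ψ‖ ^ (2 * s) ≤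
    (K * ∑ ψ, ‖fs γ (range (p ^ B)) ψ‖ ^ (2 * (s + K))) ^ ((K : ℝ) / (s + K : ℕ)) *
      (∑ ψ, ‖fs γ (cls p B b η) ψ‖ ^ (2 * (s + K))) ^ (1 - (K : ℝ) / (s + K : ℕ)) := by
  have hsr : (0 : ℝ) < s := by exact_mod_cast hs
  have hKr : (0 : ℝ) < K := by exact_mod_cast hK
  set t := s + K with ht
  have htr : (0 : ℝ) < (t : ℕ) := by rw [ht]; positivity
  set θ : ℝ := (K : ℝ) / (t : ℕ) with hθ
  have hθ0 : 0 < θ := by positivity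
  have hθ1 : θ < 1 := by rw [hθ, div_lt_one htr, ht]; push_cast; linarith
  let u : AddChar G ℂ → ℝ := fun ψ => ∑ i, (‖fs γ (cls p B (a + 1) (ξ i)) ψ‖ ^ 2) ^ t
  have hu0 : ∀ ψ, 0 ≤ u ψ := fun ψ => Finset.sum_nonneg fun i _ => by positivity
  have h2 : ∑ ψ, FF γ p B K a ξ ψ * ‖fs γ (cls p B b η) ψ‖ ^ (2 * s) ≤
      ∑ ψ, u ψ ^ θ * (‖fs γ (cls p B b η) ψ‖ ^ (2 * t)) ^ (1 - θ) := by
    refine Finset.sum_le_sum fun ψ _ => ?_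
    have e2 : ‖fs γ (cls p B b η) ψ‖ ^ (2 * s) = (‖fs γ (cls p B b η) ψ‖ ^ (2 * t)) ^ (1 - θ) := by
      rw [← Real.rpow_natCast, ← Real.rpow_natCast, ← Real.rpow_mul (norm_nonneg _)]
      congr 1
      rw [hθ]; field_simp; rw [ht]; push_cast; ring
    rw [e2]
    refine mul_le_mul_of_nonneg_right ?_ (Real.rpow_nonneg (by positivity) _)
    exact pw_holder K t hK (by omega) _ (fun i => by positivity)
  refine h2.trans ((holder univ _ _ θ hθ0 hθ1 (fun ψ _ => hu0 ψ) (fun ψ _ => by positivity)).trans ?_)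
  refine mul_le_mul_of_nonneg_right ?_ (Real.rpow_nonneg (Finset.sum_nonneg fun ψ _ => by positivity) _)
  refine Real.rpow_le_rpow (Finset.sum_nonneg fun ψ _ => hu0 ψ) ?_ hθ0.le
  simp only [u]
  rw [Finset.sum_comm]
  have : ∀ i, ∑ ψ, (‖fs γ (cls p B (a + 1) (ξ i)) ψ‖ ^ 2) ^ t ≤ ∑ ψ, ‖fs γ (range (p ^ B)) ψ‖ ^ (2 * t) := by
    intro i
    have := mean_mono (ι := Fin t) γ (A := fun _ => cls p B (a + 1) (ξ i)) (A' := fun _ => range (p ^ B))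
      (fun _ => Finset.filter_subset _ _)
    simpa [pow_mul] using this
  calc _ ≤ ∑ i : Fin K, ∑ ψ, ‖fs γ (range (p ^ B)) ψ‖ ^ (2 * t) := Finset.sum_le_sum fun i _ => this i
    _ = _ := by simp
end hold
end EC


set_option linter.unusedSectionVars false
namespace EC
open Finset

section states
variable {G : Type} [AddCommGroup G] [Fintype G] [DecidableEq G]

/-- full mean value -/
noncomputable def JJ (γ : ℕ → G) (p B t : ℕ) : ℝ := ∑ ψ : AddChar G ℂ, ‖fs γ (range (p ^ B)) ψ‖ ^ (2 * t)

/-- record property -/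
def Rec (γ : ℕ → G) (p B t : ℕ) (l : ℝ) : Prop :=
  0 < JJ γ p B t ∧ ∀ b ≤ B, ∀ η < p ^ b, ∑ ψ : AddChar G ℂ, ‖fs γ (cls p B b η) ψ‖ ^ (2 * t) ≤
    JJ γ p B t * (p : ℝ) ^ (-(l * b))

/-- state -/
def St (γ : ℕ → G) (p B K s a b : ℕ) (E : ℝ) : Prop :=
  ∃ ξ0 ξ η, Cond p K a ξ0 ξ ∧ η < p ^ b ∧ JJ γ p B (s + K) * (p : ℝ) ^ (-E) ≤
    ∑ ψ, FF γ p B K a ξ ψ * ‖fs γ (cls p B b η) ψ‖ ^ (2 * s)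

/-- broad state -/
def BSt (γ : ℕ → G) (p B K s a b : ℕ) (E : ℝ) : Prop :=
  ∃ ξ0 ξ η ζ, Cond p K a ξ0 ξ ∧ Cond p K b η ζ ∧ η < p ^ b ∧ JJ γ p B (s + K) * (p : ℝ) ^ (-E) ≤
    ∑ ψ, FF γ p B K a ξ ψ * (FF γ p B K b ζ ψ * ‖fs γ (cls p B b η) ψ‖ ^ (2 * (s - K)))

theorem JJ_nonneg (γ : ℕ → G) (p B t : ℕ) : 0 ≤ JJ γ p B t :=
  Finset.sum_nonneg fun _ _ => by positivity

theorem cls_zero (p B : ℕ) : cls p B 0 0 = range (p ^ B) := by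
  unfold cls; ext x; simp [Nat.mod_one]

theorem rpow_shift (p : ℕ) (hp : 1 < p) (J V E : ℝ) (n : ℕ) (h : J * (p : ℝ) ^ (-E) ≤ (p : ℝ) ^ n * V) :
    J * (p : ℝ) ^ (-(E + n)) ≤ V := by
  have hp0 : (0 : ℝ) < p := by exact_mod_cast (by omega : 0 < p)
  have e : (p : ℝ) ^ (-(E + n)) = (p : ℝ) ^ (-E) / (p : ℝ) ^ n := by
    rw [neg_add, Real.rpow_add hp0, Real.rpow_neg hp0.le (n : ℝ), Real.rpow_natCast]; rfl
  rw [e, ← mul_div_assoc, div_le_iff₀ (by positivity)]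
  linarith

theorem start (γ : ℕ → G) (p B K s : ℕ) (l : ℝ) (hp : 1 < p) (hK : 0 < K)
    (hpn : 2 * (2 * K) ^ (2 * (s + K)) ≤ p) (hB : 1 ≤ B) (hl : 2 < l) (hR : Rec γ p B (s + K) l) :
    St γ p B K s 0 0 (5 * K + 1 : ℕ) := by
  have hp0 : (1 : ℝ) < p := by exact_mod_cast hp
  have e0 : ∑ ψ : AddChar G ℂ, (1 : ℝ) * ‖fs γ (cls p B 0 0) ψ‖ ^ (2 * (s + K)) = JJ γ p B (s + K) := by
    simp only [cls_zero, JJ, one_mul]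
  rcases broad_narrow γ p B K 0 0 (s + K) hp hK (by omega) hpn (by simp) (fun _ => (1 : ℝ)) (fun _ => zero_le_one) with
    ⟨ζ, hζ, h⟩ | ⟨η', h1, h2, h⟩
  · refine ⟨0, ζ, 0, hζ, by simp, ?_⟩
    rw [e0] at h
    have := rpow_shift p hp (JJ γ p B (s + K)) _ 0 (5 * K + 1) (by simpa using h)
    rw [zero_add] at this
    refine this.trans (le_of_eq ?_)
    refine Finset.sum_congr rfl fun ψ _ => ?_
    rw [show 2 * (s + K) - 2 * K = 2 * s by omega]
  · exfalso
    rw [e0] at h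
    simp only [one_mul] at h
    have h3 := hR.2 1 hB η' h1
    have hJ := hR.1
    have h4 : JJ γ p B (s + K) ≤ (p : ℝ) ^ 2 * (JJ γ p B (s + K) * (p : ℝ) ^ (-(l * (1 : ℕ)))) :=
      h.trans (by gcongr)
    have h5 : (p : ℝ) ^ 2 * (p : ℝ) ^ (-(l * (1 : ℕ))) < 1 := by
      rw [← Real.rpow_natCast, ← Real.rpow_add (by linarith)]
      refine Real.rpow_lt_one_of_one_lt_of_neg hp0 ?_
      push_cast; linarith
    nlinarith

theorem descend (γ : ℕ → G) (p B K s a b b' : ℕ) (E : ℝ) (hp : 1 < p) (hs : 0 < s) (hb : b ≤ b')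
    (h : St γ p B K s a b E) : St γ p B K s a b' (E + (2 * s * (b' - b) : ℕ)) := by
  obtain ⟨ξ0, ξ, η, hξ, hη, hV⟩ := h
  by_contra hcon
  simp only [St, not_exists, not_and, not_le] at hcon
  have hp0 : (1 : ℝ) < p := by exact_mod_cast hp
  set d := b' - b with hd
  have hcard : ((lft p b b' η).card : ℝ) ≤ (p : ℝ) ^ d := by exact_mod_cast lft_card p b b' η (by omega) hb
  have hpt : ∀ ψ, FF γ p B K a ξ ψ * ‖fs γ (cls p B b η) ψ‖ ^ (2 * s) ≤
      ∑ z ∈ lft p b b' η, ((p : ℝ) ^ d) ^ (2 * s - 1) * (FF γ p B K a ξ ψ * ‖fs γ (cls p B b' z) ψ‖ ^ (2 * s)) := by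
    intro ψ
    rw [← Finset.mul_sum, ← Finset.mul_sum, mul_left_comm]
    refine mul_le_mul_of_nonneg_left ?_ (FF_nonneg ..)
    rw [fs_split γ p B b b' η (by omega) hb]
    obtain ⟨n, hn⟩ : ∃ n, 2 * s = n + 1 := ⟨2 * s - 1, by omega⟩
    rw [hn, Nat.add_sub_cancel]
    calc _ ≤ (∑ z ∈ lft p b b' η, ‖fs γ (cls p B b' z) ψ‖) ^ (n + 1) := by
          gcongr; exact norm_sum_le _ _
      _ ≤ ((lft p b b' η).card : ℝ) ^ n * ∑ z ∈ lft p b b' η, ‖fs γ (cls p B b' z) ψ‖ ^ (n + 1) :=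
          pow_sum_le_card_mul_sum_pow (fun z _ => by positivity) n
      _ ≤ _ := by gcongr
  have h1 := hV.trans (Finset.sum_le_sum (s := univ) fun ψ _ => hpt ψ)
  rw [Finset.sum_comm] at h1
  simp_rw [← Finset.mul_sum] at h1
  have hne := lft_nonempty p b b' η (by omega) hb hη
  have h2 : ∑ z ∈ lft p b b' η, ∑ ψ, FF γ p B K a ξ ψ * ‖fs γ (cls p B b' z) ψ‖ ^ (2 * s) <
      ∑ z ∈ lft p b b' η, JJ γ p B (s + K) * (p : ℝ) ^ (-(E + (2 * s * d : ℕ))) := by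
    refine Finset.sum_lt_sum_of_nonempty hne fun z hz => ?_
    simp only [lft, mem_filter, mem_range] at hz
    exact hcon ξ0 ξ z hξ hz.1
  rw [sum_const, nsmul_eq_mul] at h2
  have hJ := JJ_nonneg γ p B (s + K)
  have h3 : JJ γ p B (s + K) * (p : ℝ) ^ (-E) < ((p : ℝ) ^ d) ^ (2 * s - 1) * ((p : ℝ) ^ d * (JJ γ p B (s + K) * (p : ℝ) ^ (-(E + (2 * s * d : ℕ))))) := by
    refine h1.trans_lt (mul_lt_mul_of_pos_left (h2.trans_le ?_) (by positivity))
    gcongr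
  refine lt_irrefl _ (h3.trans_eq ?_)
  obtain ⟨n, hn⟩ : ∃ n, 2 * s = n + 1 := ⟨2 * s - 1, by omega⟩
  rw [neg_add, Real.rpow_add (by linarith : (0:ℝ) < p), Real.rpow_neg (by linarith : (0:ℝ) ≤ p) ((2 * s * d : ℕ) : ℝ), Real.rpow_natCast, hn,
    Nat.add_sub_cancel]
  have : (p : ℝ) ^ ((n + 1) * d) = ((p : ℝ) ^ d) ^ n * (p : ℝ) ^ d := by ring
  rw [this]
  have : (p : ℝ) ≠ 0 := by linarith
  field_simp

theorem triv_state (γ : ℕ → G) (p B K s a b : ℕ) (E l : ℝ) (hp : 1 < p) (hK : 0 < K) (hs : 0 < s) (hKp : K ≤ p)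
    (hbB : b ≤ B) (hR : Rec γ p B (s + K) l) (h : St γ p B K s a b E) :
    l * s / (s + K : ℕ) * b - 1 ≤ E := by
  obtain ⟨ξ0, ξ, η, hξ, hη, hV⟩ := h
  have hp0 : (1 : ℝ) < p := by exact_mod_cast hp
  have hpp : (0 : ℝ) < p := by linarith
  have hsr : (0 : ℝ) < s := by exact_mod_cast hs
  have hKr : (0 : ℝ) < K := by exact_mod_cast hK
  have htr : (0 : ℝ) < (s + K : ℕ) := by positivity
  have hJ := hR.1
  have hθ1 : (K : ℝ) / (s + K : ℕ) < 1 := by rw [div_lt_one htr]; push_cast; linarith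
  have h1 := hV.trans (triv_bound γ p B K a b η s hK hs ξ)
  have h2 := hR.2 b hbB η hη
  set J := JJ γ p B (s + K) with hJd
  set θ := (K : ℝ) / (s + K : ℕ) with hθ
  have hθ0 : 0 < θ := by positivity
  have h3 : J * (p : ℝ) ^ (-E) ≤ (p * J) ^ θ * (J * (p : ℝ) ^ (-(l * b))) ^ (1 - θ) := by
    refine h1.trans (mul_le_mul ?_ ?_ (Real.rpow_nonneg (Finset.sum_nonneg fun _ _ => by positivity) _) (by positivity))
    · refine Real.rpow_le_rpow (mul_nonneg hKr.le (JJ_nonneg γ p B (s + K))) ?_ hθ0.le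
      refine mul_le_mul_of_nonneg_right (by exact_mod_cast hKp) hJ.le
    · exact Real.rpow_le_rpow (Finset.sum_nonneg fun _ _ => by positivity) h2 (by linarith)
  rw [Real.mul_rpow hpp.le hJ.le, Real.mul_rpow hJ.le (by positivity), ← Real.rpow_mul hpp.le] at h3
  have e1 : (p : ℝ) ^ θ * J ^ θ * (J ^ (1 - θ) * (p : ℝ) ^ (-(l * b) * (1 - θ))) =
      J * (p : ℝ) ^ (θ + -(l * b) * (1 - θ)) := by
    rw [Real.rpow_add hpp]
    have : J ^ θ * J ^ (1 - θ) = J := by rw [← Real.rpow_add hJ]; simp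
    calc _ = (J ^ θ * J ^ (1 - θ)) * ((p : ℝ) ^ θ * (p : ℝ) ^ (-(l * b) * (1 - θ))) := by ring
      _ = _ := by rw [this]
  rw [e1] at h3
  have h4 := (Real.rpow_le_rpow_left_iff hp0).mp (le_of_mul_le_mul_left h3 hJ)
  have e2 : l * s / (s + K : ℕ) = l * (1 - θ) := by
    rw [hθ]; field_simp; push_cast; ring
  rw [e2]
  nlinarith

theorem bn_state (γ : ℕ → G) (p B K s a b : ℕ) (E : ℝ) (hp : 1 < p) (hK : 0 < K) (hKs : K ≤ s)
    (hpn : 2 * (2 * K) ^ (2 * s) ≤ p) (h : St γ p B K s a b E) :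
    BSt γ p B K s a b (E + (5 * K + 1 : ℕ)) ∨ St γ p B K s a (b + 1) (E + (2 : ℕ)) := by
  obtain ⟨ξ0, ξ, η, hξ, hη, hV⟩ := h
  rcases broad_narrow γ p B K b η s hp hK hKs hpn hη (fun ψ => FF γ p B K a ξ ψ) (fun _ => FF_nonneg ..) with
    ⟨ζ, hζ, h⟩ | ⟨η', h1, h2, h⟩
  · left
    refine ⟨ξ0, ξ, η, ζ, hξ, hζ, hη, ?_⟩
    rw [Nat.mul_sub]
    exact rpow_shift p hp _ _ _ _ (hV.trans h)
  · right
    refine ⟨ξ0, ξ, η', hξ, h1, ?_⟩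
    exact rpow_shift p hp _ _ _ _ (hV.trans h)

end states

theorem ec_step (p K s B N : ℕ) [NeZero N] [Fact p.Prime] (hN : N = (s + K) * p ^ (B * K) + 1)
    (hK : 0 < K) (hKp : K < p) (hKs : K < s) (a b b' : ℕ) (E l : ℝ) (hab : a + 1 ≤ b') (hbB : b ≤ B)
    (hR : Rec (gam K N) p B (s + K) l) (h : BSt (gam K N) p B K s a b E) :
    St (gam K N) p B K s b b' ((s : ℝ) / K * (E + ((∑ j : Fin K, (b' - ((j : ℕ) + 1) * b) + ∑ j : Fin K, (j : ℕ) * a : ℕ) : ℝ)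
      + (b' - a : ℕ) * K - l * b * (1 - (K : ℝ) / s)) + 1) := by
  obtain ⟨ξ0, ξ, η, ζ, hξ, hζ, hη, hV⟩ := h
  set C := ∑ j : Fin K, (b' - ((j : ℕ) + 1) * b) + ∑ j : Fin K, (j : ℕ) * a with hC
  set E' := (s : ℝ) / K * (E + (C : ℝ) + (b' - a : ℕ) * K - l * b * (1 - (K : ℝ) / s)) + 1 with hE'
  by_contra hcon
  simp only [St, not_exists, not_and, not_le] at hcon
  have hp : 1 < p := (Fact.out : p.Prime).one_lt
  have hp0 : (1 : ℝ) < p := by exact_mod_cast hp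
  have hpp : (0 : ℝ) < p := by linarith
  have hs : 0 < s := by omega
  have hsr : (0 : ℝ) < s := by exact_mod_cast hs
  have hKr : (0 : ℝ) < K := by exact_mod_cast hK
  have hKsr : (K : ℝ) < s := by exact_mod_cast hKs
  have hJ := hR.1
  have h1 := hV.trans (congr_step p K (s + K) B N hN hKp a b b' η ξ0 (s - K) (by omega) ξ ζ hξ hζ hab)
  have h2 := holder_step (gam K N) p B K a b b' η s (by omega) hK hKp.le hKs ξ ζ hζ hab _
    (fun z hz => (hcon η ζ z hζ hz).le)
  have h3 := hR.2 b hbB η hη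
  set J := JJ (gam K N) p B (s + K) with hJd
  set θ := (K : ℝ) / s with hθ
  have hθ0 : 0 < θ := by positivity
  have hθ1 : θ < 1 := by rw [hθ, div_lt_one hsr]; exact hKsr
  have h4 : J * (p : ℝ) ^ (-E) ≤ (p : ℝ) ^ C * (((p : ℝ) ^ ((b' - a) * s) * (J * (p : ℝ) ^ (-E'))) ^ θ *
      (J * (p : ℝ) ^ (-(l * b))) ^ (1 - θ)) := by
    refine h1.trans (mul_le_mul_of_nonneg_left (h2.trans ?_) (by positivity))
    refine mul_le_mul_of_nonneg_left ?_ (by positivity)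
    exact Real.rpow_le_rpow (Finset.sum_nonneg fun _ _ => by positivity) h3 (by linarith)
  have e1 : (p : ℝ) ^ C * (((p : ℝ) ^ ((b' - a) * s) * (J * (p : ℝ) ^ (-E'))) ^ θ *
      (J * (p : ℝ) ^ (-(l * b))) ^ (1 - θ)) = J * (p : ℝ) ^ ((C : ℝ) + ((b' - a : ℕ) * s : ℝ) * θ + -E' * θ + -(l * b) * (1 - θ)) := by
    rw [Real.mul_rpow (by positivity) (by positivity), Real.mul_rpow hJ.le (by positivity),
      Real.mul_rpow hJ.le (by positivity), ← Real.rpow_mul hpp.le, ← Real.rpow_mul hpp.le, Real.rpow_add hpp,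
      Real.rpow_add hpp, Real.rpow_add hpp, Real.rpow_natCast, Real.rpow_mul hpp.le ((b' - a : ℕ) * s : ℝ) θ]
    have : (p : ℝ) ^ ((b' - a : ℕ) * s : ℝ) = (p : ℝ) ^ ((b' - a) * s) := by
      rw [← Real.rpow_natCast]; push_cast; rfl
    rw [this]
    have : J ^ θ * J ^ (1 - θ) = J := by rw [← Real.rpow_add hJ]; simp
    calc _ = (J ^ θ * J ^ (1 - θ)) * ((p : ℝ) ^ C * ((p : ℝ) ^ ((b' - a) * s)) ^ θ * (p : ℝ) ^ (-E' * θ) * (p : ℝ) ^ (-(l * b) * (1 - θ))) := by ring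
      _ = _ := by rw [this]
  rw [e1] at h4
  have h5 := (Real.rpow_le_rpow_left_iff hp0).mp (le_of_mul_le_mul_left h4 hJ)
  have e2 : E' * θ = (E + (C : ℝ) + (b' - a : ℕ) * K - l * b * (1 - θ)) + θ := by
    rw [hE', hθ]; field_simp
  have e3 : ((b' - a : ℕ) * s : ℝ) * θ = (b' - a : ℕ) * K := by
    rw [hθ]; field_simp
  rw [e3] at h5
  linarith
end EC


set_option linter.unusedSectionVars false
namespace EC
open Finset

/-- modulus -/
def Nn (p K s B : ℕ) : ℕ := (s + K) * p ^ (B * K) + 1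

instance (p K s B : ℕ) : NeZero (Nn p K s B) := ⟨by unfold Nn; omega⟩

/-- states are reached with given loss -/
def Clm (p K s : ℕ) (l e d : ℝ) : Prop :=
  ∀ b0 : ℕ, ∃ U : ℕ, ∀ B, U ≤ B → Rec (gam K (Nn p K s B)) p B (s + K) l →
    ∃ a b : ℕ, ∃ E : ℝ, St (gam K (Nn p K s B)) p B K s a b E ∧ b0 ≤ b ∧ b ≤ U ∧ s * a ≤ K * (b + 1) ∧ E ≤ e * b + d

section iter
variable (p K s : ℕ) [hpF : Fact p.Prime]

theorem Clm_start (l : ℝ) (hK : 0 < K) (hs : 0 < s) (hpn : 2 * (2 * K) ^ (2 * (s + K)) ≤ p) (hl : 2 < l) :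
    Clm p K s l (2 * s) (5 * K + 1) := by
  intro b0
  refine ⟨b0 + 1, fun B hB hR => ?_⟩
  have hp := hpF.out.one_lt
  have h1 := start (gam K (Nn p K s B)) p B K s l hp hK hpn (by omega) hl hR
  have h2 := descend _ p B K s 0 0 b0 _ hp hs (by omega) h1
  refine ⟨0, b0, _, h2, le_refl _, by omega, by omega, ?_⟩
  push_cast
  simp; linarith

theorem cond_state (B a b H : ℕ) (E l : ℝ) (hK : 0 < K) (hKs : K < s) (hKp : K < p)
    (hpn : 2 * (2 * K) ^ (2 * s) ≤ p)
    (hR : Rec (gam K (Nn p K s B)) p B (s + K) l) (h : St (gam K (Nn p K s B)) p B K s a b E)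
    (hB : b + H ≤ B) (hH : E + 2 * H < l * s / (s + K : ℕ) * (b + H : ℕ) - 1) :
    ∃ h', h' < H ∧ BSt (gam K (Nn p K s B)) p B K s a (b + h') (E + 2 * h' + (5 * K + 1 : ℕ)) := by
  by_contra hcon
  push Not at hcon
  have hp := hpF.out.one_lt
  have key : ∀ h', h' ≤ H → St (gam K (Nn p K s B)) p B K s a (b + h') (E + 2 * h') := by
    intro h'
    induction h' with
    | zero => intro _; simpa using h
    | succ n ih =>
      intro hn
      rcases bn_state _ p B K s a (b + n) _ hp hK hKs.le hpn (ih (by omega)) with h1 | h1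
      · exact absurd h1 (hcon n (by omega))
      · have e : E + 2 * (n : ℝ) + ((2 : ℕ) : ℝ) = E + 2 * ((n + 1 : ℕ) : ℝ) := by push_cast; ring
        rw [e] at h1
        exact h1
  have := triv_state _ p B K s a (b + H) _ l hp hK (by omega) hKp.le hB hR (key H le_rfl)
  linarith

theorem Clm_step (l e d g : ℝ) (hK : 0 < K) (hKs : K < s) (hKp : K < p)
    (hpn : 2 * (2 * K) ^ (2 * s) ≤ p) (he : 2 ≤ e) (hg0 : 0 < g) (hg1 : g ≤ 1)
    (hLK : (K : ℝ) ≤ ∑ j : Fin K, (j : ℝ)) (hτ : 3 ≤ l * s / (s + K : ℕ))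
    (hg : g ≤ l * (1 - (K : ℝ) / s) - ∑ j : Fin K, max 0 ((s : ℝ) / K - ((j : ℕ) + 1)) - s
      - (∑ j : Fin K, (j : ℝ) - K) * K / s)
    (h : Clm p K s l e d) : ∃ d', Clm p K s l (e - g) d' := by
  set L := ∑ j : Fin K, (j : ℝ) with hL
  set c := ∑ j : Fin K, max 0 ((s : ℝ) / K - ((j : ℕ) + 1)) with hc
  set ν := (s : ℝ) / K with hν
  have hKr : (0 : ℝ) < K := by exact_mod_cast hK
  have hKsr : (K : ℝ) < s := by exact_mod_cast hKs
  have hsr : (0 : ℝ) < s := by linarith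
  have hν0 : 0 < ν := by positivity
  refine ⟨(L - K) + ν * (d + (5 * K + 1 : ℕ)) + 1 + (e - g), ?_⟩
  intro b0
  obtain ⟨U, hU⟩ := h (b0 + K)
  set H := ⌈e * U + |d|⌉₊ + 2 with hH
  refine ⟨s * (U + H), fun B hB hR => ?_⟩
  have hUB : U + H ≤ B := le_trans (Nat.le_mul_of_pos_left _ (by omega)) hB
  obtain ⟨a, b, E, hSt, hb0, hbU, hab, hE⟩ := hU B (by omega) hR
  have hHr : e * U + |d| + 2 ≤ H := by
    rw [hH]; push_cast
    linarith [Nat.le_ceil (e * U + |d|)]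
  have hbUr : (b : ℝ) ≤ U := by exact_mod_cast hbU
  obtain ⟨h', hh', hBS⟩ := cond_state p K s B a b H E l hK hKs hKp hpn hR hSt (by omega) (by
    have h1 : (3 : ℝ) * (b + H : ℕ) ≤ l * s / (s + K : ℕ) * (b + H : ℕ) := by gcongr
    have h2 : e * b ≤ e * U := by gcongr
    have h3 := le_abs_self d
    push_cast at h1 ⊢
    have h4 : (0 : ℝ) ≤ b := by positivity
    linarith)
  set β := b + h' with hβ
  set b' := s * β / K with hb'
  have hKb : K * b' ≤ s * β := Nat.mul_div_le _ _
  have hKb2 : s * β < K * (b' + 1) := Nat.lt_mul_div_succ _ hK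
  have hβb : β ≤ b' := by
    rw [hb', Nat.le_div_iff_mul_le hK, mul_comm]; gcongr
  have hab1 : a + 1 ≤ b' := by
    rw [hb', Nat.le_div_iff_mul_le hK]
    have h1 : (K + 1) * a ≤ s * a := Nat.mul_le_mul_right _ hKs
    have h2 : (K + 1) * β ≤ s * β := Nat.mul_le_mul_right _ hKs
    have h3 : (K + 1) * a ≤ K * (β + 1) := h1.trans (hab.trans (Nat.mul_le_mul_left _ (by omega)))
    have h4 : K ≤ β := by omega
    refine le_trans ?_ h2
    by_contra hlt
    push Not at hlt
    -- (K+1)β < (a+1)K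
    have h5 : (K + 1) * ((K + 1) * β) < (K + 1) * ((a + 1) * K) := Nat.mul_lt_mul_of_pos_left hlt (by omega)
    have h6 : K * ((K + 1) * a) ≤ K * (K * (β + 1)) := Nat.mul_le_mul_left _ h3
    have h7 : K * K ≤ K * β := Nat.mul_le_mul_left _ h4
    nlinarith
  have hst := ec_step p K s B (Nn p K s B) rfl hK hKp hKs a β b' _ l hab1 (by omega) hR hBS
  refine ⟨β, b', _, hst, by omega, ?_, ?_, ?_⟩
  · calc b' ≤ s * β := Nat.div_le_self _ _
      _ ≤ s * (U + H) := by gcongr; omega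
  · exact hKb2.le
  · -- numeric estimate
    have rb1 : (b' : ℝ) ≤ ν * β := by
      rw [hν, div_mul_eq_mul_div, le_div_iff₀ hKr]
      have : ((K * b' : ℕ) : ℝ) ≤ ((s * β : ℕ) : ℝ) := by exact_mod_cast hKb
      push_cast at this; linarith
    have rb2 : ν * β ≤ b' + 1 := by
      rw [hν, div_mul_eq_mul_div, div_le_iff₀ hKr]
      have : ((s * β : ℕ) : ℝ) ≤ ((K * (b' + 1) : ℕ) : ℝ) := by exact_mod_cast hKb2.le
      push_cast at this; linarith
    have ra : ν * a ≤ β + 1 := by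
      rw [hν, div_mul_eq_mul_div, div_le_iff₀ hKr]
      have : ((s * a : ℕ) : ℝ) ≤ ((K * (b + 1) : ℕ) : ℝ) := by exact_mod_cast hab
      have h2 : (b : ℝ) ≤ β := by exact_mod_cast (by omega : b ≤ β)
      push_cast at this
      nlinarith
    have rC : ((∑ j : Fin K, (b' - ((j : ℕ) + 1) * β) + ∑ j : Fin K, (j : ℕ) * a : ℕ) : ℝ) ≤ c * β + L * a := by
      push_cast
      refine add_le_add ?_ (le_of_eq ?_)
      · rw [hc, Finset.sum_mul]
        refine Finset.sum_le_sum fun j _ => ?_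
        have hβ0 : (0 : ℝ) ≤ β := by positivity
        rcases le_total (((j : ℕ) + 1) * β) b' with hle | hle
        · rw [Nat.cast_sub hle]
          push_cast
          have : ν - ((j : ℕ) + 1) ≤ max 0 (ν - ((j : ℕ) + 1)) := le_max_right _ _
          nlinarith
        · rw [Nat.sub_eq_zero_of_le hle]
          simp only [Nat.cast_zero]
          exact mul_nonneg (le_max_left _ _) hβ0
      · rw [hL, Finset.sum_mul]
    have rba : ((b' - a : ℕ) : ℝ) = b' - a := by rw [Nat.cast_sub (by omega)]
    have rE : E + 2 * h' ≤ e * β + d := by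
      rw [hβ]; push_cast
      have : (0:ℝ) ≤ h' := by positivity
      nlinarith
    rw [rba]
    set x := (β : ℝ) with hx
    have hx0 : 0 ≤ x := by positivity
    set θ := (K : ℝ) / s with hθ
    have hνθ : ν * θ = 1 := by rw [hν, hθ]; field_simp
    have hKν : ν * K = s := by rw [hν]; field_simp
    have s1 : E + 2 * h' + (5 * K + 1 : ℕ) + ((∑ j : Fin K, (b' - ((j : ℕ) + 1) * β) + ∑ j : Fin K, (j : ℕ) * a : ℕ) : ℝ)
        + (b' - a) * K - l * x * (1 - θ) ≤ (e * x + d) + (5 * K + 1 : ℕ) + c * x + (L - K) * a + ν * x * K - l * x * (1 - θ) := by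
      have : (b' : ℝ) * K ≤ ν * x * K := by gcongr
      linarith
    have s2 := mul_le_mul_of_nonneg_left s1 hν0.le
    have s3 : (L - K) * (ν * a) ≤ (L - K) * (x + 1) := mul_le_mul_of_nonneg_left ra (by linarith)
    have hg' : g ≤ l * (1 - θ) - c - s - (L - K) * θ := by
      rw [hθ]; rw [← mul_div_assoc]; exact hg
    have s4 : (ν * x) * g ≤ (ν * x) * (l * (1 - θ) - c - s - (L - K) * θ) :=
      mul_le_mul_of_nonneg_left hg' (by positivity)
    have s5 : (ν * x) * (e - g) ≤ (b' + 1) * (e - g) := mul_le_mul_of_nonneg_right rb2 (by linarith)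
    have s6 : (ν * x) * ((L - K) * θ) = (L - K) * x := by
      calc _ = (ν * θ) * ((L - K) * x) := by ring
        _ = _ := by rw [hνθ, one_mul]
    have s7 : ν * (ν * x * K) = (ν * x) * s := by rw [← hKν]; ring
    refine (add_le_add_left s2 1).trans ?_
    generalize ((5 * K + 1 : ℕ) : ℝ) = A5
    clear_value x θ ν c L
    clear s2 s1 rC hst hBS hSt hR hU
    linarith

theorem no_record (l : ℝ) (hK : 0 < K) (hKs : K < s) (hpn : 2 * (2 * K) ^ (2 * (s + K)) ≤ p) (hs4 : 4 ≤ s)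
    (hLK : (K : ℝ) ≤ ∑ j : Fin K, (j : ℝ)) (hl : ((s + K : ℕ) : ℝ) ≤ l)
    (hg : 0 < l * (1 - (K : ℝ) / s) - ∑ j : Fin K, max 0 ((s : ℝ) / K - ((j : ℕ) + 1)) - s
      - (∑ j : Fin K, (j : ℝ) - K) * K / s) :
    ∃ U : ℕ, ∀ B, U ≤ B → ¬ Rec (gam K (Nn p K s B)) p B (s + K) l := by
  have hKp : K < p := by
    have : 2 * K ≤ (2 * K) ^ (2 * (s + K)) := Nat.le_self_pow (by omega) _
    omega
  have hpn' : 2 * (2 * K) ^ (2 * s) ≤ p := by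
    refine le_trans ?_ hpn
    gcongr <;> omega
  have hs4r : (4 : ℝ) ≤ s := by exact_mod_cast hs4
  have htr : (0 : ℝ) < (s + K : ℕ) := by exact_mod_cast (by omega : 0 < s + K)
  set τ := l * s / (s + K : ℕ) with hτ
  have hτ4 : 4 ≤ τ := by
    rw [hτ, le_div_iff₀ htr]; nlinarith
  set g0 := l * (1 - (K : ℝ) / s) - ∑ j : Fin K, max 0 ((s : ℝ) / K - ((j : ℕ) + 1)) - s
      - (∑ j : Fin K, (j : ℝ) - K) * K / s with hg0
  set g := min 1 g0 with hgd
  have hgpos : 0 < g := lt_min one_pos hg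
  have key : ∀ n : ℕ, (∃ e d, 2 ≤ e ∧ e < τ ∧ Clm p K s l e d) ∨ (2 ≤ 2 * s - n * g ∧ ∃ d, Clm p K s l (2 * s - n * g) d) := by
    intro n
    induction n with
    | zero =>
      right
      refine ⟨by simp; linarith, 5 * K + 1, ?_⟩
      have h2l : (2 : ℝ) < l := by
        have : (4 : ℝ) ≤ (s + K : ℕ) := by exact_mod_cast (by omega : 4 ≤ s + K)
        linarith
      simpa using Clm_start p K s l hK (by omega) hpn h2l
    | succ n ih =>
      rcases ih with h | ⟨h1, d, h2⟩
      · exact Or.inl h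
      · by_cases hlt : 2 * s - n * g < τ
        · exact Or.inl ⟨_, d, h1, hlt, h2⟩
        · right
          push Not at hlt
          have hg1 : g ≤ 1 := min_le_left _ _
          obtain ⟨d', hd'⟩ := Clm_step p K s l _ d g hK hKs hKp hpn' h1 hgpos hg1 hLK (by linarith) (min_le_right _ _) h2
          have e : 2 * (s : ℝ) - n * g - g = 2 * s - (n + 1 : ℕ) * g := by push_cast; ring
          rw [e] at hd'
          refine ⟨?_, d', hd'⟩
          rw [← e]; linarith
  obtain ⟨n, hn⟩ := exists_nat_gt (2 * (s : ℝ) / g)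
  rw [div_lt_iff₀ hgpos] at hn
  rcases key n with ⟨e, d, he, heτ, hC⟩ | ⟨h1, _⟩
  · obtain ⟨b0, hb0⟩ := exists_nat_gt ((d + 1) / (τ - e))
    rw [div_lt_iff₀ (by linarith)] at hb0
    obtain ⟨U, hU⟩ := hC b0
    refine ⟨U, fun B hB hR => ?_⟩
    obtain ⟨a, b, E, hSt, hb, hbU, _, hE⟩ := hU B hB hR
    have := triv_state _ p B K s a b E l hpF.out.one_lt hK (by omega) hKp.le (by omega) hR hSt
    have hbr : (b0 : ℝ) ≤ b := by exact_mod_cast hb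
    have : (b0 : ℝ) * (τ - e) ≤ b * (τ - e) := by gcongr
    linarith
  · linarith
end iter
end EC


set_option linter.unusedSectionVars false
namespace EC
open Finset

/-- Vinogradov count -/
def Jc (p K t n : ℕ) : ℕ :=
  ((Fintype.piFinset (fun _ : Fin t => range (p ^ n)) ×ˢ Fintype.piFinset (fun _ : Fin t => range (p ^ n))).filter
    (fun q => ∀ j : Fin K, ∑ i, q.1 i ^ ((j : ℕ) + 1) = ∑ i, q.2 i ^ ((j : ℕ) + 1))).card

theorem cnt_cls_le (p K t B N b η : ℕ) (hp : 0 < p) (hN : N = t * p ^ (B * K) + 1) (hb : b ≤ B) :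
    cnt (gam K N) (fun _ : Fin t => cls p B b η) ≤ Jc p K t (B - b) := by
  unfold cnt Jc
  have hpb : 0 < p ^ b := by positivity
  refine Finset.card_le_card_of_injOn (fun q => (fun i => q.1 i / p ^ b, fun i => q.2 i / p ^ b)) ?_ ?_
  · intro q hq
    simp only [coe_filter, mem_product, Fintype.mem_piFinset, cls, mem_filter, mem_range, Set.mem_ofPred_eq] at hq ⊢
    obtain ⟨⟨h1, h2⟩, h3⟩ := hq
    have hlt : ∀ x : ℕ, x < p ^ B → x / p ^ b < p ^ (B - b) := by
      intro x hx
      rw [Nat.div_lt_iff_lt_mul hpb, ← pow_add, Nat.sub_add_cancel hb]; exact hx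
    refine ⟨⟨fun i => hlt _ (h1 i).1, fun i => hlt _ (h2 i).1⟩, fun j => ?_⟩
    have h0 := nowrap p K t B N hN hp (by simp) q.1 q.2 (fun i => (h1 i).1) (fun i => (h2 i).1) h3
    have h4 := shift 0 0 (η : ℤ) K (fun i => ((q.1 i : ℕ) : ℤ)) (fun i => ((q.2 i : ℕ) : ℤ)) (by
      intro j hj
      rw [Int.modEq_zero_iff]
      simp only [sub_zero]
      exact_mod_cast h0 j hj) j j.2
    rw [Int.modEq_zero_iff] at h4
    have e : ∀ x : ℕ, x % p ^ b = η → (x : ℤ) - η = (p : ℤ) ^ b * ((x / p ^ b : ℕ) : ℤ) := by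
      intro x hx
      have := Nat.div_add_mod x (p ^ b)
      rw [hx] at this
      have h3 : (x : ℤ) = (p : ℤ) ^ b * ((x / p ^ b : ℕ) : ℤ) + η := by exact_mod_cast this.symm
      linarith
    have e1 : ∀ x : Fin t → ℕ, (∀ i, x i % p ^ b = η) → ∑ i, ((x i : ℤ) - η) ^ ((j : ℕ) + 1) =
        ((p : ℤ) ^ b) ^ ((j : ℕ) + 1) * ∑ i, ((x i / p ^ b : ℕ) : ℤ) ^ ((j : ℕ) + 1) := by
      intro x hx
      rw [Finset.mul_sum]
      refine Finset.sum_congr rfl fun i _ => ?_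
      rw [e _ (hx i), mul_pow]
    rw [e1 _ (fun i => (h1 i).2), e1 _ (fun i => (h2 i).2)] at h4
    have hpz : ((p : ℤ) ^ b) ^ ((j : ℕ) + 1) ≠ 0 := by positivity
    have h5 := mul_left_cancel₀ hpz h4
    exact_mod_cast h5
  · intro q hq q' hq' hqq
    simp only [coe_filter, mem_product, Fintype.mem_piFinset, cls, mem_filter, mem_range, Set.mem_ofPred_eq] at hq hq' hqq
    have inj : ∀ x y : ℕ, x % p ^ b = η → y % p ^ b = η → x / p ^ b = y / p ^ b → x = y := by
      intro x y hx hy hxy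
      rw [← Nat.div_add_mod x (p ^ b), ← Nat.div_add_mod y (p ^ b), hxy, hx, hy]
    rw [Prod.mk.injEq] at hqq
    refine Prod.ext (funext fun i => ?_) (funext fun i => ?_)
    · exact inj _ _ (hq.1.1 i).2 (hq'.1.1 i).2 (congrFun hqq.1 i)
    · exact inj _ _ (hq.1.2 i).2 (hq'.1.2 i).2 (congrFun hqq.2 i)

theorem le_cnt (p K t B N : ℕ) : Jc p K t B ≤ cnt (gam K N) (fun _ : Fin t => range (p ^ B)) := by
  unfold cnt Jc
  refine Finset.card_le_card ?_
  intro q hq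
  rw [mem_filter] at hq ⊢
  refine ⟨hq.1, ?_⟩
  funext j
  simp only [Finset.sum_apply, gam]
  exact_mod_cast congrArg (Nat.cast (R := ZMod N)) (hq.2 j)

theorem Jc_pos (p K t n : ℕ) (hp : 0 < p) : 0 < Jc p K t n := by
  unfold Jc
  refine Finset.card_pos.mpr ⟨(fun _ => 0, fun _ => 0), ?_⟩
  simp [hp]

theorem rec_of (p K s B : ℕ) (l : ℝ) (hp : 0 < p)
    (h : ∀ b ≤ B, (Jc p K (s + K) (B - b) : ℝ) ≤ Jc p K (s + K) B * (p : ℝ) ^ (-(l * b))) :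
    Rec (gam K (Nn p K s B)) p B (s + K) l := by
  have hD : (0 : ℝ) < Fintype.card (Fin K → ZMod (Nn p K s B)) := by exact_mod_cast Fintype.card_pos
  have hJ : (Fintype.card (Fin K → ZMod (Nn p K s B)) : ℝ) * Jc p K (s + K) B ≤ JJ (gam K (Nn p K s B)) p B (s + K) := by
    have h1 := mean_eq (ι := Fin (s + K)) (gam K (Nn p K s B)) (fun _ => range (p ^ B))
    simp only [Finset.prod_const, card_univ, Fintype.card_fin, ← pow_mul] at h1
    unfold JJ
    rw [h1]
    gcongr
    exact le_cnt p K (s + K) B _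
  have hJc : (0 : ℝ) < Jc p K (s + K) B := by exact_mod_cast Jc_pos p K (s + K) B hp
  refine ⟨lt_of_lt_of_le (by positivity) hJ, fun b hb η hη => ?_⟩
  have h1 := mean_eq (ι := Fin (s + K)) (gam K (Nn p K s B)) (fun _ => cls p B b η)
  simp only [Finset.prod_const, card_univ, Fintype.card_fin, ← pow_mul] at h1
  rw [h1]
  have h2 : (cnt (gam K (Nn p K s B)) (fun _ : Fin (s + K) => cls p B b η) : ℝ) ≤ Jc p K (s + K) (B - b) := by
    exact_mod_cast cnt_cls_le p K (s + K) B _ b η hp rfl hb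
  calc _ ≤ (Fintype.card (Fin K → ZMod (Nn p K s B)) : ℝ) * (Jc p K (s + K) B * (p : ℝ) ^ (-(l * b))) := by
        gcongr; exact h2.trans (h b hb)
    _ = (Fintype.card (Fin K → ZMod (Nn p K s B)) : ℝ) * Jc p K (s + K) B * (p : ℝ) ^ (-(l * b)) := by ring
    _ ≤ _ := by gcongr

theorem exists_record (p : ℕ) (hp : 1 < p) (J : ℕ → ℝ) (c l l0 : ℝ) (hc : 0 < c) (hl : l < l0)
    (hJ : ∀ n : ℕ, c * (p : ℝ) ^ (l0 * n) ≤ J n) (U : ℕ) :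
    ∃ B, U ≤ B ∧ ∀ b ≤ B, J (B - b) ≤ J B * (p : ℝ) ^ (-(l * b)) := by
  have hp1 : (1 : ℝ) < p := by exact_mod_cast hp
  have hpp : (0 : ℝ) < p := by linarith
  have ht : Filter.Tendsto (fun n : ℕ => J n * (p : ℝ) ^ (-(l * n))) Filter.atTop Filter.atTop := by
    have h1 : Filter.Tendsto (fun n : ℕ => c * ((p : ℝ) ^ (l0 - l)) ^ n) Filter.atTop Filter.atTop :=
      (tendsto_pow_atTop_atTop_of_one_lt (Real.one_lt_rpow hp1 (by linarith))).const_mul_atTop hc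
    refine Filter.tendsto_atTop_mono (fun n => ?_) h1
    calc c * ((p : ℝ) ^ (l0 - l)) ^ n = c * (p : ℝ) ^ (l0 * n) * (p : ℝ) ^ (-(l * n)) := by
          rw [mul_assoc, ← Real.rpow_add hpp, ← Real.rpow_natCast, ← Real.rpow_mul hpp.le]
          congr 2; ring
      _ ≤ _ := by gcongr; exact hJ n
  obtain ⟨B, hB, hrec⟩ := Filter.high_scores ht U
  refine ⟨B, hB, fun b hb => ?_⟩
  have h2 : J (B - b) * (p : ℝ) ^ (-(l * (B - b : ℕ))) ≤ J B * (p : ℝ) ^ (-(l * B)) := by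
    rcases Nat.eq_zero_or_pos b with h | h
    · subst h; simp
    · exact (hrec (B - b) (by omega)).le
  rw [Nat.cast_sub hb] at h2
  have e : (p : ℝ) ^ (-(l * B)) = (p : ℝ) ^ (-(l * b)) * (p : ℝ) ^ (-(l * (B - b))) := by
    rw [← Real.rpow_add hpp]; congr 1; ring
  rw [e, ← mul_assoc] at h2
  exact le_of_mul_le_mul_right h2 (by positivity)

/-- desired family -/
def Fam (k h t : ℕ) : Prop := ∃ x : Fin h → Fin t → ℕ,
  (∀ j < k, ∀ u v, ∑ i, x u i ^ (j + 1) = ∑ i, x v i ^ (j + 1)) ∧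
  (∀ u v, u ≠ v → ∑ i, x u i ^ (k + 1) ≠ ∑ i, x v i ^ (k + 1))

/-- power sum map -/
def pis (K t : ℕ) (x : Fin t → ℕ) : Fin K → ℕ := fun j => ∑ i, x i ^ ((j : ℕ) + 1)

theorem card_sq_le (p K t n : ℕ) :
    (p ^ n) ^ (2 * t) ≤ ((Fintype.piFinset (fun _ : Fin t => range (p ^ n))).image (pis K t)).card * Jc p K t n := by
  set X := Fintype.piFinset (fun _ : Fin t => range (p ^ n)) with hX
  have hXc : X.card = (p ^ n) ^ t := by rw [hX, Fintype.card_piFinset_const, card_range]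
  have h1 : X.card = ∑ v ∈ X.image (pis K t), (X.filter (fun x => pis K t x = v)).card :=
    Finset.card_eq_sum_card_image _ _
  have h2 : ∑ v ∈ X.image (pis K t), (X.filter (fun x => pis K t x = v)).card ^ 2 ≤ Jc p K t n := by
    have : Jc p K t n = ((X ×ˢ X).filter (fun q => pis K t q.1 = pis K t q.2)).card := by
      unfold Jc
      congr 1
      refine Finset.filter_congr fun q _ => ?_
      simp only [pis, funext_iff]
    rw [this, Finset.card_eq_sum_card_fiberwise (f := fun q => pis K t q.1) (t := X.image (pis K t))]
    · refine Finset.sum_le_sum fun v _ => ?_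
      rw [sq, ← Finset.card_product]
      refine Finset.card_le_card ?_
      intro q hq
      simp only [mem_product, mem_filter] at hq ⊢
      exact ⟨⟨⟨hq.1.1, hq.2.1⟩, by rw [hq.1.2, hq.2.2]⟩, hq.1.2⟩
    · intro q hq
      simp only [coe_filter, mem_product, Set.mem_ofPred_eq] at hq
      simp only [coe_image]
      exact ⟨q.1, hq.1.1, rfl⟩
  have h3 := sq_sum_le_card_mul_sum_sq (s := X.image (pis K t)) (f := fun v => (X.filter (fun x => pis K t x = v)).card)
  rw [← h1, hXc] at h3
  calc (p ^ n) ^ (2 * t) = ((p ^ n) ^ t) ^ 2 := by rw [mul_comm 2 t, pow_mul]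
    _ ≤ _ := h3
    _ ≤ _ := Nat.mul_le_mul_left _ h2

theorem image_card_le (p k h t n : ℕ) (hp : 0 < p) (hno : ¬ Fam k h t) :
    ((Fintype.piFinset (fun _ : Fin t => range (p ^ n))).image (pis (k + 1) t)).card ≤
      h * ((t + 1) ^ k * p ^ (n * ∑ j : Fin k, ((j : ℕ) + 1))) := by
  classical
  set X := Fintype.piFinset (fun _ : Fin t => range (p ^ n)) with hX
  have hmaps : ∀ v ∈ X.image (pis (k + 1) t), (fun j : Fin k => v j.castSucc) ∈ X.image (pis k t) := by
    intro v hv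
    obtain ⟨x, hx, rfl⟩ := mem_image.mp hv
    exact mem_image.mpr ⟨x, hx, rfl⟩
  have hfib : ∀ w ∈ X.image (pis k t),
      ((X.image (pis (k + 1) t)).filter (fun v => (fun j : Fin k => v j.castSucc) = w)).card ≤ h := by
    intro w _
    by_contra hlt
    push Not at hlt
    set Φ := (X.image (pis (k + 1) t)).filter (fun v => (fun j : Fin k => v j.castSucc) = w) with hΦ
    obtain ⟨S, hS, hSc⟩ := Finset.exists_subset_card_eq hlt.le
    let f : Fin h → (Fin (k + 1) → ℕ) := fun i => S.equivFin.symm (Fin.cast hSc.symm i)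
    have hf : ∀ i, f i ∈ Φ := fun i => hS (S.equivFin.symm (Fin.cast hSc.symm i)).2
    have hfi : Function.Injective f := by
      intro i j hij
      have := S.equivFin.symm.injective (Subtype.ext hij)
      exact Fin.cast_injective _ this
    have hex : ∀ i, ∃ x : Fin t → ℕ, pis (k + 1) t x = f i := by
      intro i
      obtain ⟨x, _, hx⟩ := mem_image.mp (mem_filter.mp (hf i)).1
      exact ⟨x, hx⟩
    choose x hx using hex
    have hlow : ∀ j (hj : j < k) u, ∑ i, x u i ^ (j + 1) = w ⟨j, hj⟩ := by
      intro j hj u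
      have h1 := congrFun (mem_filter.mp (hf u)).2 ⟨j, hj⟩
      rw [← hx u] at h1
      exact h1
    refine hno ⟨x, ?_, ?_⟩
    · intro j hj u v
      rw [hlow j hj u, hlow j hj v]
    · intro u v huv heq
      apply huv
      apply hfi
      rw [← hx u, ← hx v]
      funext j
      refine Fin.lastCases ?_ (fun j => ?_) j
      · simpa [pis] using heq
      · simp only [pis, Fin.val_castSucc]
        rw [hlow j j.2 u, hlow j j.2 v]
  have h1 := Finset.card_le_mul_card_image_of_maps_to hmaps h hfib
  refine h1.trans (Nat.mul_le_mul_left _ ?_)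
  have h2 : X.image (pis k t) ⊆ Fintype.piFinset (fun j : Fin k => range (t * p ^ (n * ((j : ℕ) + 1)) + 1)) := by
    intro v hv
    obtain ⟨x, hx, rfl⟩ := mem_image.mp hv
    rw [Fintype.mem_piFinset]
    intro j
    rw [mem_range, Nat.lt_succ_iff, pis]
    have hx' := Fintype.mem_piFinset.mp hx
    calc _ ≤ ∑ _i : Fin t, p ^ (n * ((j : ℕ) + 1)) := by
          refine Finset.sum_le_sum fun i _ => ?_
          rw [pow_mul]
          exact Nat.pow_le_pow_left (mem_range.mp (hx' i)).le _
      _ = _ := by simp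
  refine (Finset.card_le_card h2).trans ?_
  rw [Fintype.card_piFinset]
  simp only [card_range]
  calc _ ≤ ∏ j : Fin k, ((t + 1) * p ^ (n * ((j : ℕ) + 1))) := by
        refine Finset.prod_le_prod (fun _ _ => Nat.zero_le _) fun j _ => ?_
        have : 1 ≤ p ^ (n * ((j : ℕ) + 1)) := Nat.one_le_pow _ _ hp
        rw [Nat.add_mul, one_mul]
        omega
    _ = _ := by
        rw [Finset.prod_mul_distrib, Finset.prod_pow_eq_pow_sum, ← Finset.mul_sum]
        simp

theorem fam_of (k h s : ℕ) (hh : 0 < h) (hk : 2 ≤ k) (hKs : k + 1 < s)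
    (hnum : ∑ j : Fin (k + 1), max 0 ((s : ℝ) / (k + 1 : ℕ) - ((j : ℕ) + 1)) + ∑ j : Fin (k + 1), (j : ℝ)
      + (k + 1 : ℕ) * (k + 1 : ℕ) / (s : ℝ) < s) : Fam k h (s + (k + 1)) := by
  by_contra hno
  set K := k + 1 with hK
  set t := s + K with ht
  set L := ∑ j : Fin K, (j : ℝ) with hL
  set c := ∑ j : Fin K, max 0 ((s : ℝ) / K - ((j : ℕ) + 1)) with hc
  have hc0 : 0 ≤ c := Finset.sum_nonneg fun _ _ => le_max_left _ _
  have hsr : (0 : ℝ) < s := by exact_mod_cast (by omega : 0 < s)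
  have hKr : (0 : ℝ) < K := by exact_mod_cast (by omega : 0 < K)
  have hKsr : (K : ℝ) < s := by exact_mod_cast hKs
  have htr : (t : ℝ) = s + K := by rw [ht]; push_cast; ring
  obtain ⟨p, hpn, hpp⟩ := Nat.exists_infinite_primes (2 * (2 * K) ^ (2 * (s + K)))
  have : Fact p.Prime := ⟨hpp⟩
  have hLsum : L = ((∑ j : Fin k, ((j : ℕ) + 1) : ℕ) : ℝ) := by
    rw [hL, hK, Fin.sum_univ_succ]
    simp
  have hLK : (K : ℝ) ≤ L := by
    rw [hLsum]
    have : k + 1 ≤ ∑ j : Fin k, ((j : ℕ) + 1) := by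
      obtain ⟨m, rfl⟩ : ∃ m, k = m + 2 := ⟨k - 2, by omega⟩
      rw [Fin.sum_univ_castSucc, Fin.sum_univ_castSucc]
      simp only [Fin.val_last, Fin.val_castSucc]
      omega
    exact_mod_cast this
  set θ := (K : ℝ) / s with hθ
  have hθ0 : 0 < θ := by positivity
  have hθ1 : θ < 1 := by rw [hθ, div_lt_one hsr]; exact hKsr
  have hsθ : s * θ = K := by rw [hθ]; field_simp
  have hKK : (K : ℝ) * K / s = K * θ := by rw [hθ]; ring
  rw [hKK] at hnum
  set g0 := s - (c + L + K * θ) with hg0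
  have hg0p : 0 < g0 := by linarith
  set l0 := 2 * (t : ℝ) - L with hl0
  set l := l0 - g0 / 2 with hl
  have hgc : 0 < l * (1 - θ) - c - s - (L - K) * K / s := by
    have : (L - K) * K / s = (L - K) * θ := by rw [hθ]; ring
    rw [this]
    have e : l * (1 - θ) - c - s - (L - K) * θ = g0 - g0 / 2 * (1 - θ) := by
      rw [hl, hl0, hg0, htr]
      linear_combination (-2) * hsθ
    rw [e]
    nlinarith
  obtain ⟨U, hU⟩ := no_record p K s l (by omega) hKs hpn (by omega) hLK (by
    rw [← ht, hl, hl0, htr]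
    have : 0 < K * θ := by positivity
    linarith) hgc
  have hlow : ∀ n : ℕ, (1 / (h * (t + 1 : ℝ) ^ k)) * (p : ℝ) ^ (l0 * n) ≤ (Jc p K t n : ℝ) := by
    intro n
    have h1 := card_sq_le p K t n
    have h2 := image_card_le p k h t n hpp.pos hno
    rw [← hK] at h2
    have h3 := h1.trans (Nat.mul_le_mul_right _ h2)
    set Q := ∑ j : Fin k, ((j : ℕ) + 1) with hQ
    have h4 : ((p : ℝ) ^ n) ^ (2 * t) ≤ (h * ((t + 1 : ℝ) ^ k * (p : ℝ) ^ (n * Q))) * Jc p K t n := by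
      exact_mod_cast h3
    have hppr : (0 : ℝ) < p := by exact_mod_cast hpp.pos
    have hhr : (0 : ℝ) < h := by exact_mod_cast hh
    have e : (p : ℝ) ^ (l0 * n) = ((p : ℝ) ^ n) ^ (2 * t) / (p : ℝ) ^ (n * Q) := by
      rw [← pow_mul, ← Real.rpow_natCast, ← Real.rpow_natCast, ← Real.rpow_sub hppr, hl0, hLsum]
      congr 1; push_cast; ring
    rw [e, one_div, ← div_eq_inv_mul, div_div, div_le_iff₀ (by positivity)]
    refine h4.trans (le_of_eq ?_)
    ring
  have hhr : (0 : ℝ) < h := by exact_mod_cast hh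
  obtain ⟨B, hB, hrec⟩ := exists_record p hpp.one_lt (fun n => (Jc p K t n : ℝ)) (1 / (h * (t + 1 : ℝ) ^ k)) l l0 (by positivity) (by rw [hl]; linarith) hlow U
  exact hU B hB (rec_of p K s B l hpp.pos hrec)
end EC


set_option linter.unusedSectionVars false
namespace EC
open Finset

theorem csum (K : ℕ) : ∀ ν : ℝ, ∑ j : Fin K, max 0 (ν - ((j : ℕ) + 1)) ≤ (ν - 1 / 2) ^ 2 / 2 := by
  induction K with
  | zero => intro ν; simp; positivity
  | succ n ih =>
    intro ν
    rw [Fin.sum_univ_succ]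
    have e : ∀ j : Fin n, ν - (((j.succ : Fin (n + 1)) : ℕ) + 1) = (ν - 1) - ((j : ℕ) + 1) := by
      intro j; rw [Fin.val_succ]; push_cast; ring
    simp only [e, Fin.val_zero, Nat.cast_zero, zero_add]
    have h := ih (ν - 1)
    rcases le_total 1 ν with h1 | h1
    · rw [max_eq_right (by linarith)]
      nlinarith
    · rw [max_eq_left (by linarith), Finset.sum_eq_zero]
      · rw [zero_add]; positivity
      · intro j _
        rw [max_eq_left]
        have : (0 : ℝ) ≤ (j : ℕ) := by positivity
        linarith

theorem Lsum (K : ℕ) : ∑ j : Fin K, (j : ℝ) = K * (K - 1) / 2 := by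
  induction K with
  | zero => simp
  | succ n ih =>
    rw [Fin.sum_univ_castSucc]
    simp only [Fin.val_castSucc, Fin.val_last]
    rw [ih]; push_cast; ring

theorem numerA (x v : ℝ) (hv : 0 ≤ v) (hxv : x = (12 / 5 + v) ^ 2 / 2) :
    x + 1 < x ^ 2 - (12 / 5 + v) * x + 3 * x - 1 := by
  rw [← sub_pos, hxv]
  ring_nf
  positivity

set_option maxHeartbeats 1000000 in
theorem numerB (x v : ℝ) (hv : 0 ≤ v) (hxv : x = (12 / 5 + v) ^ 2 / 2) :
    (2 * (12 / 5 + v) * x - x + 5) ^ 2 * (x ^ 2 - (12 / 5 + v) * x + 3 * x - 1)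
      < 8 * (x + 1) ^ 3 * ((x ^ 2 - (12 / 5 + v) * x + 3 * x - 1) - (x + 1)) := by
  rw [← sub_pos, hxv]
  ring_nf
  positivity

theorem numerC (K σ σ0 y Y : ℝ) (hKp : 0 < K) (hsigp : K < σ0) (hσ : σ0 ≤ σ)
    (hy0 : 0 ≤ y) (hyY : (y + 1 / 2) * (2 * K) ≤ Y)
    (hpoly : Y ^ 2 * σ0 < 8 * K ^ 3 * (σ0 - K)) :
    (y + 1 / 2) ^ 2 / 2 + K * K / σ < K := by
  have hσp : 0 < σ0 := by linarith
  have hy2 : ((y + 1 / 2) * (2 * K)) ^ 2 ≤ Y ^ 2 := pow_le_pow_left₀ (by positivity) hyY 2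
  have h2 : K * K / σ ≤ K * K / σ0 := div_le_div_of_nonneg_left (by positivity) hσp hσ
  have h3 : (y + 1 / 2) ^ 2 ≤ Y ^ 2 / (4 * K ^ 2) := by
    rw [le_div_iff₀ (by positivity)]; linarith
  have h4 : Y ^ 2 / (4 * K ^ 2) / 2 + K * K / σ0 < K := by
    have : Y ^ 2 / (4 * K ^ 2) / 2 + K * K / σ0 = (Y ^ 2 * σ0 + 8 * K ^ 4) / (8 * K ^ 2 * σ0) := by
      field_simp
      ring
    rw [this, div_lt_iff₀ (by positivity)]
    linarith
  linarith

theorem numerD (x v σ : ℝ) (hv : 0 ≤ v) (hxv : x = (12 / 5 + v) ^ 2 / 2)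
    (hs1 : x ^ 2 - (12 / 5 + v) * x + 3 * x - 1 ≤ σ) (hs2 : σ ≤ x ^ 2 - (12 / 5 + v) * x + 3 * x) :
    (σ / (x + 1) - 1 / 2) ^ 2 / 2 + (x + 1) * ((x + 1) - 1) / 2 + (x + 1) * (x + 1) / σ < σ := by
  have hx0 : 0 ≤ x := by rw [hxv]; positivity
  have hx1 : 1 ≤ (12 / 5 + v) := by linarith
  have hA := numerA x v hv hxv
  have hB := numerB x v hv hxv
  have hxw : x ≤ (12 / 5 + v) * x := le_mul_of_one_le_left hx0 hx1
  obtain ⟨K, hK⟩ : ∃ K, K = x + 1 := ⟨_, rfl⟩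
  obtain ⟨y, hy⟩ : ∃ y, y = K - σ / K := ⟨_, rfl⟩
  have hKp : 0 < K := by linarith
  have hyK : y * K = K ^ 2 - σ := by rw [hy]; field_simp
  have hy0 : 0 ≤ y := by
    have : 0 ≤ y * K := by
      rw [hyK, hK]; nlinarith
    exact nonneg_of_mul_nonneg_left this hKp
  have hyY : (y + 1 / 2) * (2 * K) ≤ 2 * (12 / 5 + v) * x - x + 5 := by
    have : (y + 1 / 2) * (2 * K) = 2 * (K ^ 2 - σ) + K := by rw [← hyK]; ring
    rw [this, hK]
    linarith
  rw [← hK] at hA hB ⊢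
  have hfin := numerC K σ _ y _ hKp hA hs1 hy0 hyY hB
  have e : (σ / K - 1 / 2) ^ 2 / 2 + K * (K - 1) / 2 = σ - K + (y + 1 / 2) ^ 2 / 2 := by
    have : σ / K = K - y := by rw [hy]; ring
    rw [this]
    have : σ = K ^ 2 - y * K := by linarith
    rw [this]; ring
  linarith

theorem numer (k s : ℕ) (hk : 3 ≤ k) (w : ℝ) (hw0 : 0 ≤ w) (hw : w ^ 2 = 2 * k)
    (hs1 : (k : ℝ) ^ 2 - w * k + 3 * k - 1 ≤ s) (hs2 : (s : ℝ) ≤ (k : ℝ) ^ 2 - w * k + 3 * k) :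
    k + 1 < s ∧ ∑ j : Fin (k + 1), max 0 ((s : ℝ) / (k + 1 : ℕ) - ((j : ℕ) + 1)) + ∑ j : Fin (k + 1), (j : ℝ)
      + (k + 1 : ℕ) * (k + 1 : ℕ) / (s : ℝ) < s := by
  have hk3 : (3 : ℝ) ≤ k := by exact_mod_cast hk
  have hw1 : 12 / 5 ≤ w := by nlinarith
  obtain ⟨v, rfl⟩ : ∃ v, w = 12 / 5 + v := ⟨w - 12 / 5, by ring⟩
  have hv : 0 ≤ v := by linarith
  have hxv : (k : ℝ) = (12 / 5 + v) ^ 2 / 2 := by linarith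
  have hA := numerA k v hv hxv
  constructor
  · have : ((k + 1 : ℕ) : ℝ) < s := by push_cast; linarith
    exact_mod_cast this
  · have h1 := csum (k + 1) ((s : ℝ) / (k + 1 : ℕ))
    have h2 := numerD k v s hv hxv hs1 hs2
    have hKc : ((k + 1 : ℕ) : ℝ) = k + 1 := by push_cast; rfl
    rw [Lsum]
    rw [hKc] at h1 ⊢
    linarith

/-- integer family -/
def FamZ (k h t : ℕ) : Prop := ∃ x : Fin h → Fin t → ℤ,
  (∀ j, 1 ≤ j → j ≤ k → ∀ u v, ∑ i, x u i ^ j = ∑ i, x v i ^ j) ∧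
  (∀ u v, u ≠ v → ∑ i, x u i ^ (k + 1) ≠ ∑ i, x v i ^ (k + 1))

theorem Fam.toZ {k h t : ℕ} (hF : Fam k h t) : FamZ k h t := by
  obtain ⟨x, h1, h2⟩ := hF
  refine ⟨fun u i => (x u i : ℤ), ?_, ?_⟩
  · intro j hj hjk u v
    obtain ⟨j, rfl⟩ : ∃ m, j = m + 1 := ⟨j - 1, by omega⟩
    have := h1 j (by omega) u v
    simp only at this ⊢
    exact_mod_cast this
  · intro u v huv heq
    have heq' : ∑ i, (x u i : ℤ) ^ (k + 1) = ∑ i, (x v i : ℤ) ^ (k + 1) := heq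
    exact h2 u v huv (by exact_mod_cast heq')

theorem FamZ.pad {k h t S : ℕ} (hS : t ≤ S) (hF : FamZ k h t) :
    ∃ x : Fin S → Fin h → ℤ,
        (∀ j : ℕ, 1 ≤ j → j ≤ k → ∀ u v : Fin h, ∑ i, x i u ^ j = ∑ i, x i v ^ j) ∧
        (∀ u v : Fin h, u ≠ v → ∑ i, x i u ^ (k + 1) ≠ ∑ i, x i v ^ (k + 1)) := by
  obtain ⟨r, rfl⟩ := Nat.exists_eq_add_of_le hS
  obtain ⟨x, h1, h2⟩ := hF
  let y : Fin (t + r) → Fin h → ℤ := fun i u => Fin.addCases (fun i => x u i) (fun _ => 0) i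
  have e : ∀ j, 1 ≤ j → ∀ u, ∑ i, y i u ^ j = ∑ i, x u i ^ j := by
    intro j hj u
    rw [Fin.sum_univ_add]
    simp [y, Fin.addCases_left, Fin.addCases_right, zero_pow (by omega : j ≠ 0)]
  refine ⟨y, ?_, ?_⟩
  · intro j hj hjk u v
    rw [e j hj, e j hj]; exact h1 j hj hjk u v
  · intro u v huv
    rw [e _ (by omega), e _ (by omega)]; exact h2 u v huv

/-- auxiliary quadratic -/
def D2 (n : ℕ) : ℤ := ((n : ℤ) + 3) ^ 2 + ((n : ℤ) + 3) + 1
/-- auxiliary numerator -/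
def g2 (n : ℕ) : ℤ := (((n : ℤ) + 3) ^ 2 - 1) * (((n : ℤ) + 3) * ((n : ℤ) + 5)) * (2 * ((n : ℤ) + 3) + 1)

theorem D2_pos (n : ℕ) : 0 < D2 n := by unfold D2; positivity

theorem q2_anti : StrictAnti (fun n : ℕ => (g2 n : ℚ) / (D2 n : ℚ) ^ 3) := by
  refine strictAnti_nat_of_succ_lt fun n => ?_
  have h1 : (0 : ℚ) < D2 n := by exact_mod_cast D2_pos n
  have h2 : (0 : ℚ) < D2 (n + 1) := by exact_mod_cast D2_pos (n + 1)
  rw [div_lt_div_iff₀ (by positivity) (by positivity), ← sub_pos]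
  unfold g2 D2
  push_cast
  ring_nf
  positivity

theorem famZ_two (h : ℕ) : FamZ 2 h 3 := by
  classical
  obtain ⟨M, P, hMp, hP⟩ : ∃ (M : ℤ) (P : Fin h → ℤ), 0 < M ∧ ∀ u : Fin h, D2 (u : ℕ) * P u = M :=
    ⟨∏ v : Fin h, D2 (v : ℕ), fun u => ∏ v ∈ univ.erase u, D2 (v : ℕ), Finset.prod_pos fun v _ => D2_pos v,
      fun u => Finset.mul_prod_erase univ (fun v : Fin h => D2 (v : ℕ)) (mem_univ u)⟩
  obtain ⟨X, hX⟩ : ∃ X : Fin h → ℤ, ∀ u, X u = P u * (1 - (((u : ℕ) : ℤ) + 3) ^ 2) := ⟨_, fun _ => rfl⟩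
  obtain ⟨Y, hY⟩ : ∃ Y : Fin h → ℤ, ∀ u, Y u = P u * (2 * (((u : ℕ) : ℤ) + 3) + (((u : ℕ) : ℤ) + 3) ^ 2) :=
    ⟨_, fun _ => rfl⟩
  have s1 : ∀ u, X u ^ 1 + Y u ^ 1 + (-(X u + Y u)) ^ 1 = 0 := fun u => by ring
  have s2 : ∀ u, X u ^ 2 + Y u ^ 2 + (-(X u + Y u)) ^ 2 = 2 * M ^ 2 := by
    intro u
    rw [← hP u, hX, hY]
    simp only [D2]
    ring
  have s3 : ∀ u, X u ^ 3 + Y u ^ 3 + (-(X u + Y u)) ^ 3 = 3 * (P u ^ 3 * g2 (u : ℕ)) := by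
    intro u
    rw [hX, hY]
    simp only [g2]
    ring
  have hsum : ∀ (u : Fin h) (j : ℕ), ∑ i : Fin 3, (![X u, Y u, -(X u + Y u)] : Fin 3 → ℤ) i ^ j
      = X u ^ j + Y u ^ j + (-(X u + Y u)) ^ j := by
    intro u j
    rw [Fin.sum_univ_three]; rfl
  refine ⟨fun u => ![X u, Y u, -(X u + Y u)], ?_, ?_⟩
  · intro j hj hjk u v
    rw [hsum, hsum]
    obtain rfl | rfl : j = 1 ∨ j = 2 := by omega
    · rw [s1, s1]
    · rw [s2, s2]
  · intro u v huv heq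
    rw [hsum, hsum] at heq
    have heq2 : 3 * (P u ^ 3 * g2 (u : ℕ)) = 3 * (P v ^ 3 * g2 (v : ℕ)) := by
      rw [← s3, ← s3]; exact heq
    apply huv
    have h0 : P u ^ 3 * g2 (u : ℕ) = P v ^ 3 * g2 (v : ℕ) := by linarith
    have hq : ∀ u : Fin h, (g2 (u : ℕ) : ℚ) / (D2 (u : ℕ) : ℚ) ^ 3 = ((P u ^ 3 * g2 (u : ℕ) : ℤ) : ℚ) / (M : ℚ) ^ 3 := by
      intro u
      have h1 : (D2 (u : ℕ) : ℚ) ≠ 0 := by exact_mod_cast (D2_pos u).ne'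
      have h2 : (M : ℚ) ≠ 0 := by exact_mod_cast hMp.ne'
      have h3 : (M : ℚ) = D2 (u : ℕ) * P u := by rw [← hP u]; push_cast; rfl
      rw [div_eq_div_iff (pow_ne_zero 3 h1) (pow_ne_zero 3 h2), h3]
      push_cast; ring
    have := q2_anti.injective (a₁ := (u : ℕ)) (a₂ := (v : ℕ)) (by
      show (g2 (u : ℕ) : ℚ) / (D2 (u : ℕ) : ℚ) ^ 3 = (g2 (v : ℕ) : ℚ) / (D2 (v : ℕ) : ℚ) ^ 3
      rw [hq u, hq v, h0])
    exact Fin.ext this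

end EC

theorem statement18 (h k : ℕ) (hh : 2 ≤ h) (hk : 2 ≤ k) :
    ∀ s : ℕ, (k : ℝ) ^ 2 - Real.sqrt 2 * (k : ℝ) ^ ((3 : ℝ) / 2) + 4 * k ≤ (s : ℝ) →
      ∃ x : Fin s → Fin h → ℤ,
        (∀ j : ℕ, 1 ≤ j → j ≤ k → ∀ u v : Fin h, ∑ i, x i u ^ j = ∑ i, x i v ^ j) ∧
        (∀ u v : Fin h, u ≠ v → ∑ i, x i u ^ (k + 1) ≠ ∑ i, x i v ^ (k + 1)) := by
  intro S hS
  have hk0 : (0 : ℝ) < k := by exact_mod_cast (by omega : 0 < k)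
  have hw2 : Real.sqrt (2 * k) ^ 2 = 2 * k := Real.sq_sqrt (by positivity)
  have e : Real.sqrt 2 * (k : ℝ) ^ ((3 : ℝ) / 2) = Real.sqrt (2 * k) * k := by
    rw [Real.sqrt_mul (by norm_num), Real.sqrt_eq_rpow (k : ℝ), mul_assoc]
    congr 1
    rw [show (3 : ℝ) / 2 = 1 / 2 + 1 by norm_num, Real.rpow_add hk0, Real.rpow_one]
  rw [e] at hS
  set w := Real.sqrt (2 * k) with hw
  have hw0 : 0 ≤ w := Real.sqrt_nonneg _
  rcases Nat.lt_or_ge k 3 with hk3 | hk3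
  · obtain rfl : k = 2 := by omega
    refine EC.FamZ.pad ?_ (EC.famZ_two h)
    have hw2' : w = 2 := by
      rw [hw]; push_cast
      rw [show (2 : ℝ) * 2 = 2 ^ 2 by norm_num]; exact Real.sqrt_sq (by norm_num)
    rw [hw2'] at hS
    have : (3 : ℝ) ≤ S := by push_cast at hS; linarith
    exact_mod_cast this
  · set t := ⌈(k : ℝ) ^ 2 - w * k + 4 * k⌉₊ with ht
    have htS : t ≤ S := Nat.ceil_le.mpr hS
    have hk3r : (3 : ℝ) ≤ k := by exact_mod_cast hk3
    have hpos : (k : ℝ) + 1 ≤ (k : ℝ) ^ 2 - w * k + 4 * k := by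
      have : w ≤ k := by nlinarith
      nlinarith
    have h1 : (k : ℝ) ^ 2 - w * k + 4 * k ≤ t := Nat.le_ceil _
    have h2 : (t : ℝ) < (k : ℝ) ^ 2 - w * k + 4 * k + 1 := Nat.ceil_lt_add_one (by linarith)
    have h3 : k + 1 ≤ t := by
      have : ((k + 1 : ℕ) : ℝ) ≤ t := by push_cast; linarith
      exact_mod_cast this
    obtain ⟨s, hs⟩ := Nat.exists_eq_add_of_le' h3
    have hsr : (t : ℝ) = s + (k + 1) := by rw [hs]; push_cast; ring
    obtain ⟨n1, n2⟩ := EC.numer k s hk3 w hw0 hw2 (by linarith) (by linarith)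
    have hF := EC.fam_of k h s (by omega) hk n1 n2
    rw [← hs] at hF
    exact EC.FamZ.pad htS hF.toZ
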